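/- Consider the semilinear evolution equation ẋ(t)=Ax(t)+f(x(t),u(t)) on a Banach space X with mild solutions, satisfying Assumption 1 and property ◊, and let the resulting system be forward complete. Then the following statements are equivalent: (i) the system is ISS; (ii) the system is UAG and BRS; (iii) the system is ULIM, ULS and BRS; (iv) the system is ULIM and UGS; (v) the system is ULIM, 0-ULS and BRS. -/

import Mathlib

open Set Filter

/-- Class `K`: continuous, strictly increasing on `[0,∞)` and vanishing at `0`. -/
def ClassK (γ : ℝ → ℝ) : Prop :=
  ContinuousOn γ (Ici 0) ∧ StrictMonoOn γ (Ici 0) ∧ γ 0 = 0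

/-- Class `K∞`: class `K` and unbounded. -/
def ClassKinf (γ : ℝ → ℝ) : Prop :=
  ClassK γ ∧ ∀ c : ℝ, ∃ r : ℝ, 0 ≤ r ∧ c ≤ γ r

/-- The class `K∞ ∪ {0}`. -/
def ClassKinf0 (γ : ℝ → ℝ) : Prop :=
  ClassKinf γ ∨ ∀ r : ℝ, 0 ≤ r → γ r = 0

/-- The class `K ∪ {0}`. -/
def ClassK0 (γ : ℝ → ℝ) : Prop :=
  ClassK γ ∨ ∀ r : ℝ, 0 ≤ r → γ r = 0

/-- Class `L`: continuous, strictly decreasing on `[0,∞)` with limit `0` at infinity. -/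
def ClassL (γ : ℝ → ℝ) : Prop :=
  ContinuousOn γ (Ici 0) ∧ StrictAntiOn γ (Ici 0) ∧ Tendsto γ atTop (nhds 0)

/-- Class `KL`. -/
def ClassKL (β : ℝ → ℝ → ℝ) : Prop :=
  ContinuousOn (fun p : ℝ × ℝ => β p.1 p.2) ((Ici 0) ×ˢ (Ici 0)) ∧
  (∀ t : ℝ, 0 ≤ t → ClassK (fun r => β r t)) ∧
  ∀ r : ℝ, 0 < r → StrictAntiOn (β r) (Ici 0) ∧ Tendsto (β r) atTop (nhds 0)

/-- A strongly continuous semigroup of bounded linear operators on `X`. -/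
structure C0Semigroup (X : Type*) [NormedAddCommGroup X] [NormedSpace ℝ X] where
  /-- the semigroup operators -/
  T : ℝ → X →L[ℝ] X
  map_zero' : T 0 = ContinuousLinearMap.id ℝ X
  semigroup' : ∀ s : ℝ, 0 ≤ s → ∀ t : ℝ, 0 ≤ t → T (s + t) = (T s).comp (T t)
  strong_cont : ∀ x : X, ContinuousOn (fun t => T t x) (Ici 0)

variable {X U : Type*} [NormedAddCommGroup X] [NormedSpace ℝ X] [CompleteSpace X]
  [NormedAddCommGroup U] [NormedSpace ℝ U]

/-- A member of `PC(ℝ₊, U)`: a globally bounded, piecewise continuous,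
right-continuous input function (modelled on `ℝ`, only `t ≥ 0` relevant). -/
def PCin (u : ℝ → U) : Prop :=
  (∃ C : ℝ, ∀ t : ℝ, 0 ≤ t → ‖u t‖ ≤ C) ∧
  (∀ t : ℝ, 0 ≤ t → ContinuousWithinAt u (Ici t) t) ∧
  (∀ T : ℝ, 0 < T → ∃ D : Finset ℝ, ∀ t ∈ Icc (0:ℝ) T, t ∉ D →
    ContinuousWithinAt u (Ici 0) t)

/-- The sup-norm of an input: `‖u‖_𝒰 = sup_{t ≥ 0} ‖u(t)‖`. -/
noncomputable def pcNorm (u : ℝ → U) : ℝ :=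
  ⨆ t : Ici (0:ℝ), ‖u t.val‖

/-- The mild-solution property: `φ` assigns to each initial state and each admissible
input the (unique, globally defined) mild solution of `ẋ = Ax + f(x,u)`, i.e.
`x(t) = T(t)x(0) + ∫₀ᵗ T(t-s) f(x(s), u(s)) ds`, which is continuous in time. -/
def IsMildFlow (Tg : C0Semigroup X) (f : X → U → X)
    (φ : ℝ → X → (ℝ → U) → X) : Prop :=
  ∀ (x : X) (u : ℝ → U), PCin u →
    (∀ t : ℝ, 0 ≤ t →
      φ t x u = Tg.T t x + ∫ s in (0:ℝ)..t, Tg.T (t - s) (f (φ s x u) (u s))) ∧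
    ContinuousOn (fun t => φ t x u) (Ici 0)

/-- Assumption 1: `f` is Lipschitz continuous on bounded subsets of `X`, uniformly
with respect to the second argument; `f(x,·)` is continuous and `f(0,0) = 0`. -/
def Assumption1 (f : X → U → X) : Prop :=
  (∀ C : ℝ, 0 < C → ∃ L : ℝ, 0 ≤ L ∧ ∀ x y : X, ‖x‖ ≤ C → ‖y‖ ≤ C → ∀ v : U,
    ‖f x v - f y v‖ ≤ L * ‖x - y‖) ∧
  (∀ x : X, Continuous (f x)) ∧ f 0 0 = 0

/-- Property `◊`: there exist `σ ∈ K` and `r > 0` such that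
`‖f(x,v) - f(x,0)‖ ≤ σ(‖v‖)` for all `‖v‖ < r` and `‖x‖ ≤ r`. -/
def PropertyDiamond (f : X → U → X) : Prop :=
  ∃ σ, ClassK σ ∧ ∃ r : ℝ, 0 < r ∧ ∀ v : U, ‖v‖ < r → ∀ x : X, ‖x‖ ≤ r →
    ‖f x v - f x 0‖ ≤ σ ‖v‖

/-- ISS of the system with flow `φ`. -/
def pISS (φ : ℝ → X → (ℝ → U) → X) : Prop :=
  ∃ β γ, ClassKL β ∧ ClassK γ ∧
    ∀ x : X, ∀ u : ℝ → U, PCin u → ∀ t : ℝ, 0 ≤ t →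
      ‖φ t x u‖ ≤ β ‖x‖ t + γ (pcNorm u)

/-- UAG of the system with flow `φ`. -/
def pUAG (φ : ℝ → X → (ℝ → U) → X) : Prop :=
  ∃ γ, ClassKinf0 γ ∧
    ∀ ε : ℝ, 0 < ε → ∀ r : ℝ, 0 < r → ∃ τ : ℝ, 0 ≤ τ ∧
      ∀ u : ℝ → U, PCin u → ∀ x : X, ‖x‖ < r → ∀ t : ℝ, τ ≤ t →
        ‖φ t x u‖ ≤ ε + γ (pcNorm u)

/-- BRS of the system with flow `φ`. -/
def pBRS (φ : ℝ → X → (ℝ → U) → X) : Prop :=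
  ∀ C : ℝ, 0 < C → ∀ τ : ℝ, 0 < τ → ∃ M : ℝ,
    ∀ x : X, ‖x‖ ≤ C → ∀ u : ℝ → U, PCin u → pcNorm u ≤ C → ∀ t ∈ Icc (0:ℝ) τ,
      ‖φ t x u‖ ≤ M

/-- ULIM of the system with flow `φ`. -/
def pULIM (φ : ℝ → X → (ℝ → U) → X) : Prop :=
  ∃ γ, ClassK0 γ ∧
    ∀ ε : ℝ, 0 < ε → ∀ r : ℝ, 0 < r → ∃ τ : ℝ, 0 ≤ τ ∧
      ∀ x : X, ‖x‖ ≤ r → ∀ u : ℝ → U, PCin u → ∃ t ∈ Icc (0:ℝ) τ,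
        ‖φ t x u‖ ≤ ε + γ (pcNorm u)

/-- ULS of the system with flow `φ`. -/
def pULS (φ : ℝ → X → (ℝ → U) → X) : Prop :=
  ∃ σ γ, ClassKinf σ ∧ ClassKinf0 γ ∧ ∃ r : ℝ, 0 < r ∧
    ∀ t : ℝ, 0 ≤ t → ∀ x : X, ‖x‖ ≤ r → ∀ u : ℝ → U, PCin u → pcNorm u ≤ r →
      ‖φ t x u‖ ≤ σ ‖x‖ + γ (pcNorm u)

/-- UGS of the system with flow `φ`. -/
def pUGS (φ : ℝ → X → (ℝ → U) → X) : Prop :=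
  ∃ σ γ, ClassKinf σ ∧ ClassKinf0 γ ∧
    ∀ t : ℝ, 0 ≤ t → ∀ x : X, ∀ u : ℝ → U, PCin u →
      ‖φ t x u‖ ≤ σ ‖x‖ + γ (pcNorm u)

/-- 0-ULS (uniform local stability of the undisturbed system) with flow `φ`. -/
def pZeroULS (φ : ℝ → X → (ℝ → U) → X) : Prop :=
  ∃ σ, ClassKinf σ ∧ ∃ r : ℝ, 0 < r ∧
    ∀ x : X, ‖x‖ ≤ r → ∀ t : ℝ, 0 ≤ t → ‖φ t x (fun _ => 0)‖ ≤ σ ‖x‖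


open MeasureTheory Topology

/-! ### Comparison functions -/

/-- Multiplicative averaging of a monotone function. -/
noncomputable def avgM (g : ℝ → ℝ) (r : ℝ) : ℝ := ∫ s in (1:ℝ)..2, g (r * s)

lemma avgM_int {g : ℝ → ℝ} (hg : Monotone g) (r a b : ℝ) :
    IntervalIntegrable (fun s => g (r * s)) volume a b := by
  rcases le_total 0 r with h | h
  · exact Monotone.intervalIntegrable (fun a b hab => hg (mul_le_mul_of_nonneg_left hab h))
  · exact Antitone.intervalIntegrable (fun a b hab => hg (mul_le_mul_of_nonpos_left hab h))

lemma avgM_mono {g : ℝ → ℝ} (hg : Monotone g) : Monotone (avgM g) := by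
  intro a b hab
  refine intervalIntegral.integral_mono_on (by norm_num) (avgM_int hg _ _ _) (avgM_int hg _ _ _) ?_
  intro s hs
  exact hg (mul_le_mul_of_nonneg_right hab (by linarith [hs.1]))

lemma avgM_mono_fun {g g' : ℝ → ℝ} (hg : Monotone g) (hg' : Monotone g') (h : ∀ r, g r ≤ g' r)
    (r : ℝ) : avgM g r ≤ avgM g' r := by
  refine intervalIntegral.integral_mono_on (by norm_num) (avgM_int hg _ _ _) (avgM_int hg' _ _ _) ?_
  intro s hs
  exact h _

lemma avgM_nonpos {g : ℝ → ℝ} (h0 : ∀ r ≤ 0, g r = 0) {r : ℝ} (hr : r ≤ 0) : avgM g r = 0 := by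
  unfold avgM
  rw [intervalIntegral.integral_congr (g := fun _ => 0)]
  · simp
  · intro s hs
    rw [uIcc_of_le (by norm_num)] at hs
    exact h0 _ (mul_nonpos_of_nonpos_of_nonneg hr (by linarith [hs.1]))

lemma le_avgM {g : ℝ → ℝ} (hg : Monotone g) {r : ℝ} (hr : 0 ≤ r) : g r ≤ avgM g r := by
  have : ∫ s in (1:ℝ)..2, g r ≤ avgM g r := by
    refine intervalIntegral.integral_mono_on (by norm_num) (by simp) (avgM_int hg _ _ _) ?_
    intro s hs
    exact hg (by nlinarith [hs.1])
  simp only [intervalIntegral.integral_const, smul_eq_mul] at this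
  linarith

lemma avgM_le {g : ℝ → ℝ} (hg : Monotone g) {r : ℝ} (hr : 0 ≤ r) : avgM g r ≤ g (2 * r) := by
  have : avgM g r ≤ ∫ s in (1:ℝ)..2, g (2 * r) := by
    refine intervalIntegral.integral_mono_on (by norm_num) (avgM_int hg _ _ _) (by simp) ?_
    intro s hs
    exact hg (by nlinarith [hs.2])
  simp only [intervalIntegral.integral_const, smul_eq_mul] at this
  linarith

lemma avgM_nonneg {g : ℝ → ℝ} (hg : Monotone g) (h0 : ∀ r ≤ 0, g r = 0) (r : ℝ) :
    0 ≤ avgM g r := by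
  rcases le_total 0 r with h | h
  · rw [← avgM_nonpos h0 le_rfl]; exact avgM_mono hg h
  · rw [avgM_nonpos h0 h]

lemma avgM_cont {g : ℝ → ℝ} (hg : Monotone g) (h0 : ∀ r ≤ 0, g r = 0) (hc : ContinuousAt g 0) :
    Continuous (avgM g) := by
  rw [continuous_iff_continuousAt]
  intro r
  rcases lt_trichotomy r 0 with h | h | h
  · have : avgM g =ᶠ[𝓝 r] fun _ => 0 := by
      filter_upwards [Iio_mem_nhds h] with s hs
      exact avgM_nonpos h0 (le_of_lt hs)
    exact continuousAt_const.congr this.symm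
  · subst h
    unfold ContinuousAt
    rw [avgM_nonpos h0 le_rfl]
    have h2 : Tendsto (fun r : ℝ => g (2 * max r 0)) (𝓝 0) (𝓝 0) := by
      have : Tendsto (fun r : ℝ => 2 * max r 0) (𝓝 0) (𝓝 0) := by
        have hh : Continuous (fun r : ℝ => 2 * max r 0) := by fun_prop
        have := hh.tendsto 0
        simpa using this
      have h3 : Tendsto g (𝓝 0) (𝓝 0) := by
        have := hc.tendsto
        rwa [h0 0 le_rfl] at this
      exact h3.comp this
    refine tendsto_of_tendsto_of_tendsto_of_le_of_le tendsto_const_nhds h2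
      (fun r => avgM_nonneg hg h0 r) (fun r => ?_)
    exact (avgM_mono hg (le_max_left r 0)).trans (avgM_le hg (le_max_right _ _))
  · have hp : Continuous fun b => ∫ x in (0:ℝ)..b, g x :=
      intervalIntegral.continuous_primitive (fun a b => hg.intervalIntegrable) 0
    have : avgM g =ᶠ[𝓝 r] fun r => r⁻¹ * ((∫ x in (0:ℝ)..(r * 2), g x) - ∫ x in (0:ℝ)..(r*1), g x) := by
      filter_upwards [Ioi_mem_nhds h] with s hs
      unfold avgM
      rw [intervalIntegral.integral_comp_mul_left (f := g) (ne_of_gt hs),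
        intervalIntegral.integral_interval_sub_left hg.intervalIntegrable hg.intervalIntegrable]
      rfl
    refine ContinuousAt.congr ?_ this.symm
    refine (continuousAt_inv₀ h.ne').mul (Continuous.continuousAt ?_)
    exact (hp.comp (by fun_prop)).sub (hp.comp (by fun_prop))

lemma K_majorant {g : ℝ → ℝ} (hg : Monotone g) (h0 : ∀ r ≤ 0, g r = 0) (hc : ContinuousAt g 0) :
    ∃ σ, ClassKinf σ ∧ ∀ r, 0 ≤ r → g r ≤ σ r := by
  refine ⟨fun r => avgM g r + r, ⟨⟨?_, ?_, ?_⟩, ?_⟩, ?_⟩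
  · exact ((avgM_cont hg h0 hc).add continuous_id).continuousOn
  · intro a _ b _ hab
    have := avgM_mono hg hab.le
    simp only; linarith
  · simp [avgM_nonpos h0 le_rfl]
  · intro c
    refine ⟨max c 0, le_max_right _ _, ?_⟩
    have := avgM_nonneg hg h0 (max c 0)
    have := le_max_left c 0
    linarith
  · intro r hr
    have := le_avgM hg hr
    linarith

lemma joint_cont {B : ℝ → ℝ → ℝ} (hm : ∀ t, Monotone (fun r => B r t)) (ha : ∀ r, Antitone (B r))
    (hcr : ∀ t, Continuous (fun r => B r t)) (hct : ∀ r, Continuous (B r)) :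
    Continuous (fun p : ℝ × ℝ => B p.1 p.2) := by
  rw [continuous_iff_continuousAt]
  rintro ⟨r0, t0⟩
  refine tendsto_order.2 ⟨fun b hb => ?_, fun b hb => ?_⟩
  · have e1 : ∀ᶠ r in 𝓝[<] r0, b < B r t0 :=
      ((hcr t0).continuousAt.eventually (lt_mem_nhds hb)).filter_mono nhdsWithin_le_nhds
    obtain ⟨r1, h1, h1'⟩ := (e1.and self_mem_nhdsWithin).exists
    have e2 : ∀ᶠ t in 𝓝[>] t0, b < B r1 t :=
      ((hct r1).continuousAt.eventually (lt_mem_nhds h1)).filter_mono nhdsWithin_le_nhds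
    obtain ⟨t1, h2, h2'⟩ := (e2.and self_mem_nhdsWithin).exists
    filter_upwards [prod_mem_nhds (Ioi_mem_nhds h1') (Iio_mem_nhds h2')] with p hp
    exact h2.trans_le (((ha r1) (le_of_lt hp.2)).trans (hm p.2 (le_of_lt hp.1)))
  · have e1 : ∀ᶠ r in 𝓝[>] r0, B r t0 < b :=
      ((hcr t0).continuousAt.eventually (gt_mem_nhds hb)).filter_mono nhdsWithin_le_nhds
    obtain ⟨r1, h1, h1'⟩ := (e1.and self_mem_nhdsWithin).exists
    have e2 : ∀ᶠ t in 𝓝[<] t0, B r1 t < b :=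
      ((hct r1).continuousAt.eventually (gt_mem_nhds h1)).filter_mono nhdsWithin_le_nhds
    obtain ⟨t1, h2, h2'⟩ := (e2.and self_mem_nhdsWithin).exists
    filter_upwards [prod_mem_nhds (Iio_mem_nhds h1') (Ioi_mem_nhds h2')] with p hp
    exact lt_of_le_of_lt ((hm p.2 (le_of_lt hp.1)).trans ((ha r1) (le_of_lt hp.2))) h2

lemma KL_majorant {h : ℝ → ℝ → ℝ} (hm : ∀ t, Monotone (fun r => h r t)) (ha : ∀ r, Antitone (h r))
    (h0 : ∀ r ≤ 0, ∀ t, h r t = 0) (hc : ∀ t, ContinuousAt (fun r => h r t) 0)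
    (ht : ∀ r, Tendsto (h r) atTop (𝓝 0)) :
    ∃ β, ClassKL β ∧ ∀ r t, 0 ≤ r → 0 ≤ t → h r t ≤ β r t := by
  let H : ℝ → ℝ → ℝ := fun r t => avgM (fun r => h r t) r
  have Hm : ∀ t, Monotone (fun r => H r t) := fun t => avgM_mono (hm t)
  have Ha : ∀ r, Antitone (H r) := fun r a b hab =>
    avgM_mono_fun (hm b) (hm a) (fun r => ha r hab) r
  have Hc : ∀ t, Continuous (fun r => H r t) := fun t =>
    avgM_cont (hm t) (fun r hr => h0 r hr t) (hc t)
  have Hn : ∀ r t, 0 ≤ H r t := fun r t => avgM_nonneg (hm t) (fun r hr => h0 r hr t) r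
  have H0 : ∀ r ≤ 0, ∀ t, H r t = 0 := fun r hr t => avgM_nonpos (fun r hr => h0 r hr t) hr
  have HI : ∀ r a b, IntervalIntegrable (H r) volume a b := fun r a b => (Ha r).intervalIntegrable
  have HI' : ∀ r t a b, IntervalIntegrable (fun θ => H r (t + θ)) volume a b := fun r t a b =>
    Antitone.intervalIntegrable (fun x y hxy => Ha r (by linarith))
  let B : ℝ → ℝ → ℝ := fun r t => ∫ θ in (-1:ℝ)..0, H r (t + θ)
  have Bm : ∀ t, Monotone (fun r => B r t) := fun t a b hab =>
    intervalIntegral.integral_mono_on (by norm_num) (HI' _ _ _ _) (HI' _ _ _ _)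
      (fun s _ => Hm _ hab)
  have Ba : ∀ r, Antitone (B r) := fun r a b hab =>
    intervalIntegral.integral_mono_on (by norm_num) (HI' _ _ _ _) (HI' _ _ _ _)
      (fun s _ => Ha _ (by linarith))
  have Bn : ∀ r t, 0 ≤ B r t := fun r t =>
    intervalIntegral.integral_nonneg (by norm_num) (fun s _ => Hn _ _)
  have Bge : ∀ r t, H r t ≤ B r t := by
    intro r t
    have : ∫ s in (-1:ℝ)..0, H r t ≤ B r t :=
      intervalIntegral.integral_mono_on (by norm_num) (by simp) (HI' _ _ _ _)
        (fun s hs => Ha _ (by linarith [hs.2]))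
    simp only [intervalIntegral.integral_const, smul_eq_mul] at this
    linarith
  have Ble : ∀ r t, B r t ≤ H r (t - 1) := by
    intro r t
    have : B r t ≤ ∫ s in (-1:ℝ)..0, H r (t-1) :=
      intervalIntegral.integral_mono_on (by norm_num) (HI' _ _ _ _) (by simp)
        (fun s hs => Ha _ (by linarith [hs.1]))
    simp only [intervalIntegral.integral_const, smul_eq_mul] at this
    linarith
  have B0 : ∀ r ≤ 0, ∀ t, B r t = 0 := by
    intro r hr t
    have : B r t = ∫ θ in (-1:ℝ)..0, (0:ℝ) := by
      apply intervalIntegral.integral_congr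
      intro s _
      exact H0 r hr _
    simpa using this
  have Bct : ∀ r, Continuous (B r) := by
    intro r
    have hp : Continuous fun b => ∫ x in (0:ℝ)..b, H r x :=
      intervalIntegral.continuous_primitive (HI r) 0
    have : B r = fun t => (∫ x in (0:ℝ)..(t+0), H r x) - ∫ x in (0:ℝ)..(t+(-1)), H r x := by
      ext t
      rw [intervalIntegral.integral_interval_sub_left (HI _ _ _) (HI _ _ _)]
      exact intervalIntegral.integral_comp_add_left (H r) t
    rw [this]
    exact (hp.comp (by fun_prop)).sub (hp.comp (by fun_prop))
  have Bcr : ∀ t, Continuous (fun r => B r t) := by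
    intro t
    rw [continuous_iff_continuousAt]
    intro r0
    apply intervalIntegral.continuousAt_of_dominated_interval (bound := fun θ => H (r0+1) (t+θ))
    · exact Eventually.of_forall fun r => (HI' r t (-1) 0).def'.aestronglyMeasurable
    · filter_upwards [Iio_mem_nhds (lt_add_one r0)] with r hr
      refine Eventually.of_forall fun θ _ => ?_
      rw [Real.norm_of_nonneg (Hn _ _)]
      exact Hm _ (le_of_lt hr)
    · exact HI' _ _ _ _
    · exact Eventually.of_forall fun θ _ => (Hc _).continuousAt
  have BT : ∀ r, 0 ≤ r → Tendsto (B r) atTop (𝓝 0) := by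
    intro r hr
    have h1 : Tendsto (fun t : ℝ => h (2*r) (t - 1)) atTop (𝓝 0) :=
      (ht (2*r)).comp (tendsto_atTop_add_const_right _ (-1) tendsto_id)
    refine tendsto_of_tendsto_of_tendsto_of_le_of_le tendsto_const_nhds h1 (fun t => Bn r t) ?_
    intro t
    exact (Ble r t).trans (avgM_le (hm (t-1)) hr)
  have BC := joint_cont Bm Ba Bcr Bct
  refine ⟨fun r t => B r t + r * Real.exp (-t), ⟨?_, ?_, ?_⟩, ?_⟩
  · exact (BC.add (by fun_prop)).continuousOn
  · intro t _
    refine ⟨((Bcr t).add (by fun_prop)).continuousOn, ?_, by simp [B0 0 le_rfl]⟩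
    intro a _ b _ hab
    have h1 := Bm t hab.le
    have h2 := mul_lt_mul_of_pos_right hab (Real.exp_pos (-t))
    simp only at h1 ⊢
    linarith
  · intro r hr
    refine ⟨?_, ?_⟩
    · intro a _ b _ hab
      have h1 := Ba r hab.le
      have h2 : r * Real.exp (-b) < r * Real.exp (-a) :=
        mul_lt_mul_of_pos_left (Real.exp_lt_exp.2 (by linarith)) hr
      simp only
      linarith
    · have := (BT r hr.le).add (Real.tendsto_exp_neg_atTop_nhds_zero.const_mul r)
      simpa using this
  · intro r t hr _
    have h1 : h r t ≤ H r t := le_avgM (hm t) hr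
    have h2 := Bge r t
    have h3 : 0 ≤ r * Real.exp (-t) := mul_nonneg hr (Real.exp_pos _).le
    linarith

set_option linter.unusedSectionVars false

/-- Continuous, monotone and zero at zero. -/
def PreK (γ : ℝ → ℝ) : Prop :=
  ContinuousOn γ (Ici 0) ∧ MonotoneOn γ (Ici 0) ∧ γ 0 = 0

lemma ClassK.pre {γ : ℝ → ℝ} (h : ClassK γ) : PreK γ := ⟨h.1, h.2.1.monotoneOn, h.2.2⟩

lemma preK_zero {γ : ℝ → ℝ} (h : ∀ r : ℝ, 0 ≤ r → γ r = 0) : PreK γ := by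
  refine ⟨?_, ?_, h 0 le_rfl⟩
  · exact continuousOn_const.congr (fun r hr => h r hr)
  · intro a ha b hb _
    rw [h a ha, h b hb]

lemma ClassK0.pre {γ : ℝ → ℝ} (h : ClassK0 γ) : PreK γ := h.elim (·.pre) preK_zero

lemma ClassKinf0.toK0 {γ : ℝ → ℝ} (h : ClassKinf0 γ) : ClassK0 γ := h.imp (·.1) id

lemma PreK.nonneg {γ : ℝ → ℝ} (h : PreK γ) {r : ℝ} (hr : 0 ≤ r) : 0 ≤ γ r := by
  rw [← h.2.2]; exact h.2.1 self_mem_Ici hr hr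

lemma PreK.mono {γ : ℝ → ℝ} (h : PreK γ) {a b : ℝ} (ha : 0 ≤ a) (hab : a ≤ b) : γ a ≤ γ b :=
  h.2.1 ha (ha.trans hab) hab

lemma PreK.add {γ δ : ℝ → ℝ} (h : PreK γ) (h' : PreK δ) : PreK (fun r => γ r + δ r) :=
  ⟨h.1.add h'.1, fun _ ha _ hb hab => add_le_add (h.2.1 ha hb hab) (h'.2.1 ha hb hab),
    by simp [h.2.2, h'.2.2]⟩

lemma PreK.comp2 {γ δ : ℝ → ℝ} (h : PreK γ) (h' : PreK δ) : PreK (fun r => γ (2 * δ r)) := by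
  refine ⟨?_, ?_, by simp [h.2.2, h'.2.2]⟩
  · refine h.1.comp (continuousOn_const.mul h'.1) ?_
    intro r hr
    have := h'.nonneg hr
    simp only [mem_Ici]; linarith
  · intro a ha b hb hab
    have h1 := h'.nonneg ha
    have h2 := h'.mono ha hab
    exact h.mono (by linarith) (by linarith)

lemma PreK.kinf {γ : ℝ → ℝ} (h : PreK γ) : ClassKinf (fun r => γ r + r) := by
  refine ⟨⟨h.1.add continuousOn_id, ?_, by simp [h.2.2]⟩, ?_⟩
  · intro a ha b hb hab
    have := h.mono ha hab.le
    simp only; linarith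
  · intro c
    refine ⟨max c 0, le_max_right _ _, ?_⟩
    have := h.nonneg (le_max_right c 0)
    have := le_max_left c 0
    linarith

lemma PreK.small {γ : ℝ → ℝ} (h : PreK γ) {ε : ℝ} (hε : 0 < ε) :
    ∃ δ, 0 < δ ∧ ∀ r, 0 ≤ r → r ≤ δ → γ r ≤ ε := by
  have h1 := h.1 0 self_mem_Ici
  have h2 : ∀ᶠ r in 𝓝[Ici 0] (0:ℝ), γ r < ε := by
    have h3 : Tendsto γ (𝓝[Ici 0] 0) (𝓝 0) := by
      have := h1.tendsto
      rwa [h.2.2] at this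
    exact h3.eventually (gt_mem_nhds hε)
  obtain ⟨δ, hδ, hs⟩ := Metric.mem_nhdsWithin_iff.1 h2
  refine ⟨δ/2, by linarith, fun r hr hr' => le_of_lt (hs ⟨?_, hr⟩)⟩
  simp only [Metric.mem_ball, dist_zero_right, Real.norm_eq_abs, abs_of_nonneg hr]
  linarith

/-! ### Inputs -/

lemma PCin.bdd {u : ℝ → U} (h : PCin u) : BddAbove (range fun t : Ici (0:ℝ) => ‖u t.val‖) := by
  obtain ⟨C, hC⟩ := h.1
  refine ⟨C, ?_⟩
  rintro _ ⟨t, rfl⟩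
  exact hC t.1 t.2

lemma PCin.le {u : ℝ → U} (h : PCin u) {t : ℝ} (ht : 0 ≤ t) : ‖u t‖ ≤ pcNorm u :=
  le_ciSup (f := fun t : Ici (0:ℝ) => ‖u t.val‖) h.bdd ⟨t, ht⟩

lemma pcNorm_nonneg (u : ℝ → U) : 0 ≤ pcNorm u := Real.iSup_nonneg fun _ => norm_nonneg _

lemma PCin.shift {u : ℝ → U} (h : PCin u) {s : ℝ} (hs : 0 ≤ s) : PCin (fun r => u (s + r)) := by
  refine ⟨?_, ?_, ?_⟩
  · obtain ⟨C, hC⟩ := h.1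
    exact ⟨C, fun t ht => hC _ (by linarith)⟩
  · intro t ht
    have := h.2.1 (s + t) (by linarith)
    refine ContinuousWithinAt.comp (t := Ici (s+t)) this (by fun_prop) ?_
    intro r hr
    simp only [mem_Ici] at hr ⊢
    linarith
  · intro T hT
    obtain ⟨D, hD⟩ := h.2.2 (s + T) (by linarith)
    refine ⟨D.image (fun d => d - s), fun t ht htD => ?_⟩
    have := hD (s + t) ⟨by linarith [ht.1], by linarith [ht.2]⟩ (by
      intro hh
      exact htD (Finset.mem_image.2 ⟨_, hh, by ring⟩))
    refine ContinuousWithinAt.comp (t := Ici 0) this (by fun_prop) ?_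
    intro r hr
    simp only [mem_Ici] at hr ⊢
    linarith

lemma PCin.shift_le {u : ℝ → U} (h : PCin u) {s : ℝ} (hs : 0 ≤ s) :
    pcNorm (fun r => u (s + r)) ≤ pcNorm u := by
  unfold pcNorm
  exact ciSup_le fun t => h.le (by linarith [t.2.out])

lemma PCin_const (v : U) : PCin (fun _ : ℝ => v) :=
  ⟨⟨‖v‖, fun _ _ => le_rfl⟩, fun _ _ => continuousWithinAt_const,
    fun _ _ => ⟨∅, fun _ _ _ => continuousWithinAt_const⟩⟩

lemma pcNorm_zero : pcNorm (fun _ : ℝ => (0:U)) = 0 := by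
  unfold pcNorm; simp

/-! ### Abstract part -/

/-- Cocycle property. -/
def Coc (φ : ℝ → X → (ℝ → U) → X) : Prop :=
  ∀ (x : X) (u : ℝ → U), PCin u → ∀ s : ℝ, 0 ≤ s → ∀ t : ℝ, 0 ≤ t →
    φ (s + t) x u = φ t (φ s x u) (fun r => u (s + r))

/-- Local stability in epsilon-delta form. -/
def EpsDelta (φ : ℝ → X → (ℝ → U) → X) : Prop :=
  ∀ ε : ℝ, 0 < ε → ∃ δ : ℝ, 0 < δ ∧ ∀ (x : X) (u : ℝ → U) (t : ℝ), ‖x‖ ≤ δ → PCin u →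
    pcNorm u ≤ δ → 0 ≤ t → ‖φ t x u‖ ≤ ε

lemma return_bound {φ : ℝ → X → (ℝ → U) → X} (hC : Coc φ) {r c τ M : ℝ}
    (h : ∀ (x : X) (u : ℝ → U), ‖x‖ ≤ r → PCin u → pcNorm u ≤ c →
      (∃ s ∈ Icc (1:ℝ) τ, ‖φ s x u‖ ≤ r) ∧ ∀ t ∈ Icc (0:ℝ) τ, ‖φ t x u‖ ≤ M)
    (x : X) (u : ℝ → U) (hx : ‖x‖ ≤ r) (hu : PCin u) (huc : pcNorm u ≤ c)
    (t : ℝ) (ht : 0 ≤ t) : ‖φ t x u‖ ≤ M := by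
  have key : ∀ n : ℕ, ∀ (x : X) (u : ℝ → U), ‖x‖ ≤ r → PCin u → pcNorm u ≤ c →
      ∀ t : ℝ, 0 ≤ t → t ≤ n → ‖φ t x u‖ ≤ M := by
    intro n
    induction n with
    | zero =>
      intro x u hx hu huc t ht htn
      obtain ⟨⟨s, hs, _⟩, h2⟩ := h x u hx hu huc
      refine h2 t ⟨ht, ?_⟩
      have := hs.1.trans hs.2
      simp at htn; linarith
    | succ n ih =>
      intro x u hx hu huc t ht htn
      obtain ⟨⟨s, hs, hsr⟩, h2⟩ := h x u hx hu huc
      by_cases hts : t ≤ s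
      · exact h2 t ⟨ht, hts.trans hs.2⟩
      · push Not at hts
        have hs0 : 0 ≤ s := by linarith [hs.1]
        have e := hC x u hu s hs0 (t - s) (by linarith)
        rw [add_sub_cancel] at e
        rw [e]
        refine ih _ _ hsr (hu.shift hs0) ((hu.shift_le hs0).trans huc) _ (by linarith) ?_
        push_cast at htn
        linarith [hs.1]
  obtain ⟨n, hn⟩ := exists_nat_ge t
  exact key n x u hx hu huc t ht hn

lemma global_bound {φ : ℝ → X → (ℝ → U) → X} (hC : Coc φ) (hL : pULIM φ) (hB : pBRS φ)
    (C : ℝ) (hCp : 0 < C) : ∃ M, ∀ (x : X) (u : ℝ → U), ‖x‖ ≤ C → PCin u → pcNorm u ≤ C →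
      ∀ t : ℝ, 0 ≤ t → ‖φ t x u‖ ≤ M := by
  obtain ⟨γ, hγ, hlim⟩ := hL
  have hγ := hγ.pre
  set r := max C (1 + γ C) with hr
  have hr0 : 0 < r := lt_max_of_lt_left hCp
  obtain ⟨M1, hM1⟩ := hB r hr0 1 one_pos
  obtain ⟨τ, hτ0, hτ⟩ := hlim 1 one_pos (max M1 1) (lt_max_of_lt_right one_pos)
  obtain ⟨M2, hM2⟩ := hB r hr0 (1 + τ) (by linarith)
  refine ⟨M2, fun x u hx hu huC t ht => ?_⟩
  refine return_bound hC (r := r) (c := C) (τ := 1 + τ) (M := M2) ?_ x u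
    (hx.trans (le_max_left _ _)) hu huC t ht
  intro x u hx hu huC
  refine ⟨?_, fun t ht => hM2 x hx u hu (huC.trans (le_max_left _ _)) t ht⟩
  have h1 := hM1 x hx u hu (huC.trans (le_max_left _ _)) 1 ⟨zero_le_one, le_rfl⟩
  obtain ⟨s, hs, hs'⟩ := hτ (φ 1 x u) (h1.trans (le_max_left _ _)) _ (hu.shift zero_le_one)
  refine ⟨1 + s, ⟨by linarith [hs.1], by linarith [hs.2]⟩, ?_⟩
  rw [hC x u hu 1 zero_le_one s hs.1]
  refine hs'.trans (le_trans ?_ (le_max_right _ _))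
  have := hγ.mono (pcNorm_nonneg (fun r => u (1 + r))) ((hu.shift_le zero_le_one).trans huC)
  linarith

lemma ugs_of {φ : ℝ → X → (ℝ → U) → X} (hC : Coc φ) (hL : pULIM φ) (hB : pBRS φ)
    (hE : EpsDelta φ) : pUGS φ := by
  let S : ℝ → Set ℝ := fun C => {a | a = 0 ∨ ∃ (t : ℝ) (x : X) (u : ℝ → U), 0 ≤ t ∧ ‖x‖ ≤ C ∧
    PCin u ∧ pcNorm u ≤ C ∧ a = ‖φ t x u‖}
  have Smono : ∀ a b, a ≤ b → S a ⊆ S b := by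
    rintro a b hab z (hz | ⟨t, x, u, ht, hx, hu, huc, rfl⟩)
    · exact Or.inl hz
    · exact Or.inr ⟨t, x, u, ht, hx.trans hab, hu, huc.trans hab, rfl⟩
  have Sne : ∀ C, (S C).Nonempty := fun C => ⟨0, Or.inl rfl⟩
  have Sbdd : ∀ C, BddAbove (S C) := by
    intro C
    obtain ⟨M, hM⟩ := global_bound hC hL hB (max C 1) (lt_max_of_lt_right one_pos)
    refine BddAbove.mono (Smono C _ (le_max_left C 1)) ⟨max M 0, ?_⟩
    rintro z (hz | ⟨t, x, u, ht, hx, hu, huc, rfl⟩)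
    · rw [hz]; exact le_max_right _ _
    · exact (hM x u hx hu huc t ht).trans (le_max_left _ _)
  let g : ℝ → ℝ := fun C => sSup (S C)
  have gm : Monotone g := fun a b hab => csSup_le_csSup (Sbdd b) (Sne a) (Smono a b hab)
  have gn : ∀ r, 0 ≤ g r := fun r => le_csSup (Sbdd r) (Or.inl rfl)
  have gs : ∀ ε, 0 < ε → ∃ δ, 0 < δ ∧ ∀ r ≤ δ, g r ≤ ε := by
    intro ε hε
    obtain ⟨δ, hδ, h⟩ := hE ε hε
    refine ⟨δ, hδ, fun r hr => csSup_le (Sne r) ?_⟩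
    rintro z (hz | ⟨t, x, u, ht, hx, hu, huc, rfl⟩)
    · rw [hz]; exact hε.le
    · exact h x u t (hx.trans hr) hu (huc.trans hr) ht
  have g0 : ∀ r ≤ 0, g r = 0 := by
    intro r hr
    refine le_antisymm (le_of_forall_pos_le_add fun ε hε => ?_) (gn r)
    obtain ⟨δ, hδ, h⟩ := gs ε hε
    simpa using h r (by linarith)
  have gc : ContinuousAt g 0 := by
    rw [Metric.continuousAt_iff]
    intro ε hε
    obtain ⟨δ, hδ, h⟩ := gs (ε/2) (by linarith)
    refine ⟨δ, hδ, fun {r} hr => ?_⟩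
    rw [g0 0 le_rfl, dist_zero_right, Real.norm_of_nonneg (gn r)]
    rw [dist_zero_right, Real.norm_eq_abs] at hr
    have := h r ((le_abs_self r).trans hr.le)
    linarith
  obtain ⟨σ, hσ, hgσ⟩ := K_majorant gm g0 gc
  refine ⟨σ, σ, hσ, Or.inl hσ, fun t ht x u hu => ?_⟩
  have hn := pcNorm_nonneg u
  have h1 : ‖φ t x u‖ ≤ g (max ‖x‖ (pcNorm u)) :=
    le_csSup (Sbdd _) (Or.inr ⟨t, x, u, ht, le_max_left _ _, hu, le_max_right _ _, rfl⟩)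
  have h2 := hgσ (max ‖x‖ (pcNorm u)) (le_max_of_le_right hn)
  have h3 := hσ.1.pre.nonneg (norm_nonneg x)
  have h4 := hσ.1.pre.nonneg hn
  rcases max_choice ‖x‖ (pcNorm u) with h | h <;> rw [h] at h1 h2 <;> linarith

lemma iss_of {φ : ℝ → X → (ℝ → U) → X} (hC : Coc φ) (hL : pULIM φ) (hG : pUGS φ) : pISS φ := by
  obtain ⟨γ0, hγ0, hlim⟩ := hL
  obtain ⟨σ, γ1, hσ, hγ1, hgs⟩ := hG
  have hγ0 := hγ0.pre
  have hγ1 := hγ1.toK0.pre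
  have hσ := hσ.1.pre
  have hpre : PreK (fun r => σ (2 * γ0 r) + γ1 r) := (hσ.comp2 hγ0).add hγ1
  have hγ := hpre.kinf.1
  set γ : ℝ → ℝ := fun r => σ (2 * γ0 r) + γ1 r + r with hγdef
  have hγ1le : ∀ r, 0 ≤ r → γ1 r ≤ γ r := by
    intro r hr
    have h1 := hσ.nonneg (r := 2 * γ0 r) (by have := hγ0.nonneg hr; linarith)
    simp only [hγdef]; linarith
  have uag : ∀ ε, 0 < ε → ∀ r, 0 < r → ∃ τ : ℝ, 0 ≤ τ ∧ ∀ (x : X) (u : ℝ → U) (t : ℝ),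
      ‖x‖ ≤ r → PCin u → τ ≤ t → ‖φ t x u‖ ≤ ε + γ (pcNorm u) := by
    intro ε hε r hr
    obtain ⟨δ, hδ, hδσ⟩ := hσ.small hε
    obtain ⟨τ, hτ0, hτ⟩ := hlim (δ/2) (by linarith) r hr
    refine ⟨τ, hτ0, fun x u t hx hu ht => ?_⟩
    obtain ⟨s, hs, hs'⟩ := hτ x hx u hu
    have e := hC x u hu s hs.1 (t - s) (by linarith [hs.2])
    rw [add_sub_cancel] at e
    rw [e]
    have h1 := hgs (t - s) (by linarith [hs.2]) (φ s x u) _ (hu.shift hs.1)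
    have hn := pcNorm_nonneg u
    have h2 := hγ1.mono (pcNorm_nonneg _) (hu.shift_le hs.1)
    have h3 := hσ.mono (norm_nonneg _) hs'
    have h4 := hγ0.nonneg hn
    have h5 : σ (δ/2 + γ0 (pcNorm u)) ≤ ε + σ (2 * γ0 (pcNorm u)) := by
      rcases le_total (δ/2) (γ0 (pcNorm u)) with h | h
      · have := hσ.mono (a := δ/2 + γ0 (pcNorm u)) (b := 2 * γ0 (pcNorm u)) (by linarith) (by linarith)
        linarith
      · have := hδσ (δ/2 + γ0 (pcNorm u)) (by linarith) (by linarith)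
        have := hσ.nonneg (r := 2 * γ0 (pcNorm u)) (by linarith)
        linarith
    simp only [hγdef]
    linarith
  let S : ℝ → ℝ → Set ℝ := fun r t => {a | a = 0 ∨ ∃ (s : ℝ) (x : X) (u : ℝ → U), t ≤ s ∧ 0 ≤ s ∧
    ‖x‖ ≤ r ∧ PCin u ∧ a = ‖φ s x u‖ - γ (pcNorm u)}
  have Sne : ∀ r t, (S r t).Nonempty := fun r t => ⟨0, Or.inl rfl⟩
  have Sle : ∀ r t, ∀ a ∈ S r t, a ≤ σ (max r 0) := by
    rintro r t a (ha | ⟨s, x, u, hts, hs, hx, hu, rfl⟩)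
    · rw [ha]; exact hσ.nonneg (le_max_right _ _)
    · have h1 := hgs s hs x u hu
      have h2 := hγ1le _ (pcNorm_nonneg u)
      have h3 := hσ.mono (norm_nonneg x) (hx.trans (le_max_left r 0))
      linarith
  have Sbdd : ∀ r t, BddAbove (S r t) := fun r t => ⟨_, Sle r t⟩
  let h : ℝ → ℝ → ℝ := fun r t => sSup (S r t)
  have hle : ∀ r t, h r t ≤ σ (max r 0) := fun r t => csSup_le (Sne r t) (Sle r t)
  have hn : ∀ r t, 0 ≤ h r t := fun r t => le_csSup (Sbdd r t) (Or.inl rfl)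
  have h0 : ∀ r ≤ 0, ∀ t, h r t = 0 := by
    intro r hr t
    refine le_antisymm ?_ (hn r t)
    have := hle r t
    rwa [max_eq_right hr, hσ.2.2] at this
  obtain ⟨β, hβ, hhβ⟩ : ∃ β, ClassKL β ∧ ∀ r t, 0 ≤ r → 0 ≤ t → h r t ≤ β r t := by
    apply KL_majorant
    · intro t a b hab
      refine csSup_le_csSup (Sbdd b t) (Sne a t) ?_
      rintro z (hz | ⟨s, x, u, hts, hs, hx, hu, rfl⟩)
      · exact Or.inl hz
      · exact Or.inr ⟨s, x, u, hts, hs, hx.trans hab, hu, rfl⟩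
    · intro r a b hab
      refine csSup_le_csSup (Sbdd r a) (Sne r b) ?_
      rintro z (hz | ⟨s, x, u, hts, hs, hx, hu, rfl⟩)
      · exact Or.inl hz
      · exact Or.inr ⟨s, x, u, hab.trans hts, hs, hx, hu, rfl⟩
    · exact h0
    · intro t
      rw [Metric.continuousAt_iff]
      intro ε hε
      obtain ⟨δ, hδ, hs⟩ := hσ.small (half_pos hε)
      refine ⟨δ, hδ, fun {r} hr => ?_⟩
      rw [h0 0 le_rfl, dist_zero_right, Real.norm_of_nonneg (hn r t)]
      rw [dist_zero_right, Real.norm_eq_abs] at hr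
      have h1 := hs (max r 0) (le_max_right _ _) (max_le ((le_abs_self r).trans hr.le) hδ.le)
      have h2 := hle r t
      linarith
    · intro r
      rw [Metric.tendsto_atTop]
      intro ε hε
      obtain ⟨τ, hτ0, hτ⟩ := uag (ε/2) (half_pos hε) (max r 1) (lt_max_of_lt_right one_pos)
      refine ⟨τ, fun t ht => ?_⟩
      rw [dist_zero_right, Real.norm_of_nonneg (hn r t)]
      have : h r t ≤ ε/2 := by
        refine csSup_le (Sne r t) ?_
        rintro z (hz | ⟨s, x, u, hts, hs, hx, hu, rfl⟩)
        · rw [hz]; linarith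
        · have := hτ x u s (hx.trans (le_max_left _ _)) hu (ht.trans hts)
          linarith
      linarith
  refine ⟨β, γ, hβ, hγ, fun x u hu t ht => ?_⟩
  have h1 : ‖φ t x u‖ - γ (pcNorm u) ≤ h ‖x‖ t :=
    le_csSup (Sbdd _ _) (Or.inr ⟨t, x, u, le_rfl, ht, le_rfl, hu, rfl⟩)
  have h2 := hhβ ‖x‖ t (norm_nonneg x) ht
  linarith

lemma iss_imp {φ : ℝ → X → (ℝ → U) → X} (h : pISS φ) :
    pUAG φ ∧ pBRS φ ∧ pULIM φ ∧ pULS φ ∧ pUGS φ ∧ pZeroULS φ := by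
  obtain ⟨β, γ, hβ, hγ, h⟩ := h
  have hK := fun t ht => (hβ.2.1 t ht).pre
  have anti : ∀ r, 0 ≤ r → ∀ s t, 0 ≤ s → s ≤ t → β r t ≤ β r s := by
    intro r hr s t hs hst
    rcases hr.eq_or_lt with h0 | h0
    · have h1 := (hK t (hs.trans hst)).2.2
      have h2 := (hK s hs).2.2
      simp only at h1 h2
      rw [← h0, h1, h2]
    · exact (hβ.2.2 r h0).1.antitoneOn hs (hs.trans hst) hst
  have hG : ∀ t : ℝ, 0 ≤ t → ∀ x : X, ∀ u : ℝ → U, PCin u →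
      ‖φ t x u‖ ≤ (β ‖x‖ 0 + ‖x‖) + (γ (pcNorm u) + pcNorm u) := by
    intro t ht x u hu
    have h1 := h x u hu t ht
    have h2 := anti ‖x‖ (norm_nonneg x) 0 t le_rfl ht
    have h3 := pcNorm_nonneg u
    have h4 := norm_nonneg x
    linarith
  have hσ := (hK 0 le_rfl).kinf
  have hγi := hγ.pre.kinf
  have hat : ∀ ε : ℝ, 0 < ε → ∀ r : ℝ, 0 < r → ∃ τ : ℝ, 0 ≤ τ ∧
      ∀ u : ℝ → U, PCin u → ∀ x : X, ‖x‖ ≤ r → ∀ t : ℝ, τ ≤ t →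
        ‖φ t x u‖ ≤ ε + γ (pcNorm u) := by
    intro ε hε r hr
    have h1 : ∀ᶠ t in atTop, β r t < ε := (hβ.2.2 r hr).2.eventually (gt_mem_nhds hε)
    obtain ⟨τ, hτ, hτ0⟩ := (h1.and (eventually_ge_atTop 0)).exists
    refine ⟨τ, hτ0, fun u hu x hx t ht => ?_⟩
    have h2 := h x u hu t (hτ0.trans ht)
    have h3 := anti ‖x‖ (norm_nonneg x) τ t hτ0 ht
    have h4 := (hK τ hτ0).mono (norm_nonneg x) hx
    beta_reduce at h4
    linarith
  refine ⟨⟨_, Or.inl hγi, ?_⟩, ?_, ⟨γ, Or.inl hγ, ?_⟩, ⟨_, _, hσ, Or.inl hγi, 1, one_pos, ?_⟩,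
    ⟨_, _, hσ, Or.inl hγi, hG⟩, ⟨_, hσ, 1, one_pos, ?_⟩⟩
  · intro ε hε r hr
    obtain ⟨τ, h0, hτ⟩ := hat ε hε r hr
    refine ⟨τ, h0, fun u hu x hx t ht => ?_⟩
    have h1 := hτ u hu x hx.le t ht
    have h2 := pcNorm_nonneg u
    linarith
  · intro C hC τ hτ
    refine ⟨(β C 0 + C) + (γ C + C), fun x hx u hu huC t ht => ?_⟩
    have h1 := hG t ht.1 x u hu
    have h2 := hσ.1.pre.mono (norm_nonneg x) hx
    have h3 := hγi.1.pre.mono (pcNorm_nonneg u) huC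
    beta_reduce at h2 h3
    linarith
  · intro ε hε r hr
    obtain ⟨τ, h0, hτ⟩ := hat ε hε r hr
    exact ⟨τ, h0, fun x hx u hu => ⟨τ, ⟨h0, le_rfl⟩, hτ u hu x hx τ le_rfl⟩⟩
  · intro t ht x _ u hu _
    exact hG t ht x u hu
  · intro x _ t ht
    have := hG t ht x _ (PCin_const 0)
    rw [pcNorm_zero, hγ.2.2] at this
    simpa using this

lemma epsdelta_of_uls {φ : ℝ → X → (ℝ → U) → X} (h : pULS φ) : EpsDelta φ := by
  obtain ⟨σ, γ, hσ, hγ, r, hr, h⟩ := h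
  intro ε hε
  obtain ⟨δ1, h1, h1'⟩ := hσ.1.pre.small (half_pos hε)
  obtain ⟨δ2, h2, h2'⟩ := hγ.toK0.pre.small (half_pos hε)
  refine ⟨min r (min δ1 δ2), lt_min hr (lt_min h1 h2), fun x u t hx hu huc ht => ?_⟩
  simp only [le_min_iff] at hx huc
  have e1 := h t ht x hx.1 u hu huc.1
  have e2 := h1' _ (norm_nonneg x) hx.2.1
  have e3 := h2' _ (pcNorm_nonneg u) huc.2.2
  linarith

lemma brs_of_ugs {φ : ℝ → X → (ℝ → U) → X} (h : pUGS φ) : pBRS φ := by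
  obtain ⟨σ, γ, hσ, hγ, h⟩ := h
  intro C hC τ hτ
  refine ⟨σ C + γ C, fun x hx u hu huC t ht => ?_⟩
  have h1 := h t ht.1 x u hu
  have h2 := hσ.1.pre.mono (norm_nonneg x) hx
  have h3 := hγ.toK0.pre.mono (pcNorm_nonneg u) huC
  linarith

lemma ulim_of_uag {φ : ℝ → X → (ℝ → U) → X} (h : pUAG φ) : pULIM φ := by
  obtain ⟨γ, hγ, h⟩ := h
  refine ⟨γ, hγ.toK0, fun ε hε r hr => ?_⟩
  obtain ⟨τ, h0, hτ⟩ := h ε hε (r+1) (by linarith)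
  exact ⟨τ, h0, fun x hx u hu => ⟨τ, ⟨h0, le_rfl⟩, hτ u hu x (by linarith) τ le_rfl⟩⟩

/-! ### Analytic part -/

lemma T_bound (Tg : C0Semigroup X) (τ : ℝ) :
    ∃ M : ℝ, 0 ≤ M ∧ ∀ t ∈ Icc (0:ℝ) τ, ∀ x : X, ‖Tg.T t x‖ ≤ M * ‖x‖ := by
  have h : ∀ x : X, ∃ C, ∀ i : Icc (0:ℝ) τ, ‖Tg.T i.1 x‖ ≤ C := by
    intro x
    have hc : ContinuousOn (fun t => Tg.T t x) (Icc 0 τ) :=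
      (Tg.strong_cont x).mono Icc_subset_Ici_self
    obtain ⟨C, hC⟩ := isCompact_Icc.exists_bound_of_continuousOn hc
    exact ⟨C, fun i => hC i.1 i.2⟩
  obtain ⟨C, hC⟩ := banach_steinhaus h
  refine ⟨max C 0, le_max_right _ _, fun t ht x => ?_⟩
  refine (Tg.T t).le_of_opNorm_le ((hC ⟨t, ht⟩).trans (le_max_left _ _)) x

lemma T_joint (Tg : C0Semigroup X) (τ : ℝ) :
    ContinuousOn (fun p : ℝ × X => Tg.T p.1 p.2) (Icc 0 τ ×ˢ univ) := by
  obtain ⟨M, hM0, hM⟩ := T_bound Tg τ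
  refine continuousOn_prod_of_continuousOn_lipschitzOnWith' _ ⟨M, hM0⟩ ?_ ?_
  · intro t ht
    refine LipschitzOnWith.of_dist_le_mul fun x _ y _ => ?_
    rw [dist_eq_norm, dist_eq_norm, ← map_sub]
    exact hM t ht _
  · intro x _
    exact (Tg.strong_cont x).mono Icc_subset_Ici_self

lemma f_joint {f : X → U → X} (hA1 : Assumption1 f) : Continuous (fun p : X × U => f p.1 p.2) := by
  rw [continuous_iff_continuousAt]
  rintro ⟨x0, v0⟩
  obtain ⟨L, hL0, hL⟩ := hA1.1 (‖x0‖ + 1) (by positivity)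
  have : ContinuousOn (fun p : X × U => f p.1 p.2) (Metric.closedBall 0 (‖x0‖+1) ×ˢ univ) := by
    refine continuousOn_prod_of_continuousOn_lipschitzOnWith _ ⟨L, hL0⟩ ?_ ?_
    · intro x _
      exact (hA1.2.1 x).continuousOn
    · intro v _
      refine LipschitzOnWith.of_dist_le_mul fun x hx y hy => ?_
      rw [dist_eq_norm, dist_eq_norm]
      exact hL x y (by simpa using hx) (by simpa using hy) v
  refine this.continuousAt (prod_mem_nhds ?_ univ_mem)
  refine mem_of_superset (Metric.ball_mem_nhds x0 one_pos) fun y hy => ?_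
  rw [mem_closedBall_zero_iff]
  rw [mem_ball_iff_norm] at hy
  have := norm_le_norm_add_norm_sub' y x0
  linarith

lemma meas_aux (Tg : C0Semigroup X) {f : X → U → X} (hA1 : Assumption1 f) {u : ℝ → U} (hu : PCin u)
    {y : ℝ → X} {t : ℝ} (hy : ContinuousOn y (Icc 0 t)) :
    AEStronglyMeasurable (fun s => Tg.T (t - s) (f (y s) (u s))) (volume.restrict (Icc 0 t)) := by
  obtain ⟨D, hD⟩ := hu.2.2 (max t 1) (lt_max_of_lt_right one_pos)
  have hae : (Icc 0 t \ (D : Set ℝ) : Set ℝ) =ᵐ[volume] Icc 0 t :=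
    sdiff_null_ae_eq_self (D.measure_zero volume)
  rw [← Measure.restrict_congr_set hae]
  refine ContinuousOn.aestronglyMeasurable ?_ (measurableSet_Icc.diff D.measurableSet)
  intro s hs
  have h1 : ContinuousWithinAt u (Icc 0 t \ (D : Set ℝ)) s :=
    (hD s ⟨hs.1.1, hs.1.2.trans (le_max_left _ _)⟩ hs.2).mono (fun r hr => hr.1.1)
  have h2 : ContinuousWithinAt y (Icc 0 t \ (D : Set ℝ)) s := (hy s hs.1).mono sdiff_subset
  have h3 : ContinuousWithinAt (fun s => f (y s) (u s)) (Icc 0 t \ (D : Set ℝ)) s :=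
    (f_joint hA1).continuousAt.comp_continuousWithinAt (h2.prodMk h1)
  have h4 : ContinuousWithinAt (fun s => (t - s, f (y s) (u s))) (Icc 0 t \ (D : Set ℝ)) s :=
    ContinuousWithinAt.prodMk (by fun_prop) h3
  refine ContinuousWithinAt.comp (g := fun p : ℝ × X => Tg.T p.1 p.2)
    (f := fun s => (t - s, f (y s) (u s))) (t := Icc 0 t ×ˢ univ) (T_joint Tg t (t - s, f (y s) (u s)) ⟨⟨by linarith [hs.1.2], by linarith [hs.1.1]⟩, trivial⟩) h4 ?_
  intro r hr
  exact ⟨⟨by linarith [hr.1.2], by linarith [hr.1.1]⟩, trivial⟩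

lemma diff_int (Tg : C0Semigroup X) {f : X → U → X} (hA1 : Assumption1 f) {u : ℝ → U} (hu : PCin u)
    {y z : ℝ → X} {t : ℝ} (hy : ContinuousOn y (Icc 0 t)) (hz : ContinuousOn z (Icc 0 t)) (ht : 0 ≤ t)
    (h : IntervalIntegrable (fun s => Tg.T (t - s) (f (y s) (u s))) volume 0 t) :
    IntervalIntegrable (fun s => Tg.T (t - s) (f (z s) (u s))) volume 0 t := by
  obtain ⟨M, hM0, hM⟩ := T_bound Tg t
  obtain ⟨Cy, hCy⟩ := isCompact_Icc.exists_bound_of_continuousOn hy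
  obtain ⟨Cz, hCz⟩ := isCompact_Icc.exists_bound_of_continuousOn hz
  obtain ⟨L, hL0, hL⟩ := hA1.1 (max 1 (max Cy Cz)) (lt_max_of_lt_left one_pos)
  rw [intervalIntegrable_iff_integrableOn_Icc_of_le ht] at h ⊢
  have hd : IntegrableOn (fun s => Tg.T (t - s) (f (z s) (u s)) - Tg.T (t - s) (f (y s) (u s)))
      (Icc 0 t) volume := by
    refine IntegrableOn.of_bound (by simp) ((meas_aux Tg hA1 hu hz).sub (meas_aux Tg hA1 hu hy))
      (M * (L * (Cz + Cy))) ?_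
    refine (ae_restrict_iff' measurableSet_Icc).2 (Eventually.of_forall fun s hs => ?_)
    rw [← map_sub]
    refine (hM _ ⟨by linarith [hs.2], by linarith [hs.1]⟩ _).trans ?_
    refine mul_le_mul_of_nonneg_left ?_ hM0
    refine (hL _ _ ((hCz s hs).trans (by simp)) ((hCy s hs).trans (by simp)) _).trans ?_
    refine mul_le_mul_of_nonneg_left ?_ hL0
    exact (norm_sub_le _ _).trans (add_le_add (hCz s hs) (hCy s hs))
  have := hd.add h
  refine this.congr (Eventually.of_forall fun s => ?_)
  simp

lemma diff_bd (Tg : C0Semigroup X) {f : X → U → X} (hA1 : Assumption1 f) {u : ℝ → U} (hu : PCin u)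
    {y z : ℝ → X} {t M L C : ℝ} (hy : ContinuousOn y (Icc 0 t)) (hz : ContinuousOn z (Icc 0 t))
    (ht : 0 ≤ t) (hM0 : 0 ≤ M) (hM : ∀ s ∈ Icc (0:ℝ) t, ∀ x : X, ‖Tg.T s x‖ ≤ M * ‖x‖)
    (hL : ∀ x y : X, ‖x‖ ≤ C → ‖y‖ ≤ C → ∀ v : U, ‖f x v - f y v‖ ≤ L * ‖x - y‖)
    (hyC : ∀ s ∈ Icc (0:ℝ) t, ‖y s‖ ≤ C) (hzC : ∀ s ∈ Icc (0:ℝ) t, ‖z s‖ ≤ C) :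
    ‖(∫ s in (0:ℝ)..t, Tg.T (t - s) (f (y s) (u s))) - ∫ s in (0:ℝ)..t, Tg.T (t - s) (f (z s) (u s))‖
      ≤ M * L * ∫ s in (0:ℝ)..t, ‖y s - z s‖ := by
  have hint : IntervalIntegrable (fun s => M * L * ‖y s - z s‖) volume 0 t := by
    apply ContinuousOn.intervalIntegrable
    rw [uIcc_of_le ht]
    exact continuousOn_const.mul (hy.sub hz).norm
  have hpt : ∀ s ∈ Ioc 0 t, ‖Tg.T (t - s) (f (y s) (u s)) - Tg.T (t - s) (f (z s) (u s))‖ ≤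
      M * L * ‖y s - z s‖ := by
    intro s hs
    have hs' : s ∈ Icc 0 t := Ioc_subset_Icc_self hs
    rw [← map_sub, mul_assoc]
    refine (hM _ ⟨by linarith [hs.2], by linarith [hs.1]⟩ _).trans ?_
    exact mul_le_mul_of_nonneg_left (hL _ _ (hyC s hs') (hzC s hs') _) hM0
  rw [← intervalIntegral.integral_const_mul]
  by_cases h : IntervalIntegrable (fun s => Tg.T (t - s) (f (y s) (u s))) volume 0 t
  · have h' := diff_int Tg hA1 hu hy hz ht h
    rw [← intervalIntegral.integral_sub h h']
    exact intervalIntegral.norm_integral_le_of_norm_le ht (Eventually.of_forall hpt) hint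
  · have h' : ¬ IntervalIntegrable (fun s => Tg.T (t - s) (f (z s) (u s))) volume 0 t :=
      fun h' => h (diff_int Tg hA1 hu hz hy ht h')
    rw [intervalIntegral.integral_undef h, intervalIntegral.integral_undef h', sub_zero, norm_zero]
    refine intervalIntegral.integral_nonneg_of_ae_restrict ht ?_
    refine (ae_restrict_iff' measurableSet_Icc).2 ?_
    have h0 : ∀ᵐ s : ℝ, s ≠ 0 := by simp [ae_iff]
    filter_upwards [h0] with s hs0 hs
    exact (norm_nonneg _).trans (hpt s ⟨lt_of_le_of_ne hs.1 hs0.symm, hs.2⟩)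

lemma gronwall_int {δ : ℝ → ℝ} {A K c : ℝ} (hδ : ContinuousOn δ (Icc 0 c)) (hK : 0 ≤ K)
    (h : ∀ t ∈ Icc (0:ℝ) c, δ t ≤ A + K * ∫ s in (0:ℝ)..t, δ s) :
    ∀ t ∈ Icc (0:ℝ) c, δ t ≤ A * Real.exp (K * t) := by
  intro t ht
  have hc : 0 ≤ c := ht.1.trans ht.2
  let δ' : ℝ → ℝ := IccExtend hc ((Icc 0 c).domRestrict δ)
  have hδ' : Continuous δ' := (continuousOn_iff_continuous_domRestrict.1 hδ).Icc_extend'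
  have he : ∀ s ∈ Icc (0:ℝ) c, δ' s = δ s := fun s hs => by
    simp only [δ', IccExtend_of_mem hc _ hs, domRestrict_apply]
  let G : ℝ → ℝ := fun t => ∫ s in (0:ℝ)..t, δ' s
  have hG : ∀ t ∈ Icc (0:ℝ) c, G t = ∫ s in (0:ℝ)..t, δ s := by
    intro t ht
    apply intervalIntegral.integral_congr
    intro s hs
    rw [uIcc_of_le ht.1] at hs
    exact he s ⟨hs.1, hs.2.trans ht.2⟩
  have hd : ∀ t, HasDerivAt G (δ' t) t := fun t => hδ'.integral_hasStrictDerivAt 0 t |>.hasDerivAt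
  have hb := le_gronwallBound_of_liminf_deriv_right_le (f := G) (f' := δ') (δ := 0) (K := K) (ε := A)
    (a := 0) (b := c) (fun t _ => (hd t).continuousAt.continuousWithinAt)
    (fun x _ r hr => ((hd x).hasDerivWithinAt.liminf_right_slope_le hr)) (by simp [G])
    (fun x hx => by
      have hx' : x ∈ Icc 0 c := Ico_subset_Icc_self hx
      rw [he x hx', hG x hx']
      linarith [h x hx']) t ht
  have h1 := h t ht
  rw [← hG t ht] at h1
  rw [sub_zero] at hb
  have h2 := mul_le_mul_of_nonneg_left hb hK
  rcases hK.eq_or_lt with h0 | h0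
  · subst h0; simp at h1 ⊢; exact h1
  · rw [gronwallBound_of_K_ne_0 h0.ne'] at h2
    have : K * (0 * Real.exp (K * t) + A / K * (Real.exp (K * t) - 1)) = A * Real.exp (K * t) - A := by
      field_simp; ring
    linarith

/-- Mild solution on `[0,c]` (with the junk-value convention of the integral). -/
def Mild (Tg : C0Semigroup X) (f : X → U → X) (x : X) (u : ℝ → U) (y : ℝ → X) (c : ℝ) : Prop :=
  ContinuousOn y (Icc 0 c) ∧ ∀ t ∈ Icc (0:ℝ) c,
    y t = Tg.T t x + ∫ s in (0:ℝ)..t, Tg.T (t - s) (f (y s) (u s))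

lemma IsMildFlow.mild {Tg : C0Semigroup X} {f : X → U → X} {φ : ℝ → X → (ℝ → U) → X}
    (hφ : IsMildFlow Tg f φ) (x : X) {u : ℝ → U} (hu : PCin u) (c : ℝ) :
    Mild Tg f x u (fun t => φ t x u) c :=
  ⟨(hφ x u hu).2.mono Icc_subset_Ici_self, fun t ht => (hφ x u hu).1 t ht.1⟩

lemma Mild.unique {Tg : C0Semigroup X} {f : X → U → X} (hA1 : Assumption1 f) {u : ℝ → U}
    (hu : PCin u) {x : X} {y z : ℝ → X} {c : ℝ} (hy : Mild Tg f x u y c) (hz : Mild Tg f x u z c) :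
    ∀ t ∈ Icc (0:ℝ) c, y t = z t := by
  obtain ⟨M, hM0, hM⟩ := T_bound Tg c
  obtain ⟨Cy, hCy⟩ := isCompact_Icc.exists_bound_of_continuousOn hy.1
  obtain ⟨Cz, hCz⟩ := isCompact_Icc.exists_bound_of_continuousOn hz.1
  obtain ⟨L, hL0, hL⟩ := hA1.1 (max 1 (max Cy Cz)) (lt_max_of_lt_left one_pos)
  intro t ht
  have := gronwall_int (δ := fun s => ‖y s - z s‖) (A := 0) (K := M * L) (c := c)
    (hy.1.sub hz.1).norm (mul_nonneg hM0 hL0) ?_ t ht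
  · rw [zero_mul] at this
    exact sub_eq_zero.1 (norm_le_zero_iff.1 this)
  · intro t ht
    have hs : Icc 0 t ⊆ Icc 0 c := Icc_subset_Icc_right ht.2
    rw [hy.2 t ht, hz.2 t ht, add_sub_add_left_eq_sub, zero_add]
    exact diff_bd Tg hA1 hu (hy.1.mono hs) (hz.1.mono hs) ht.1 hM0 (fun s hs' => hM s (hs hs')) hL
      (fun s hs' => (hCy s (hs hs')).trans (by simp)) (fun s hs' => (hCz s (hs hs')).trans (by simp))

lemma Mild.congr_input {Tg : C0Semigroup X} {f : X → U → X} {u u' : ℝ → U}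
    {x : X} {y : ℝ → X} {c : ℝ} (hy : Mild Tg f x u y c) (h : ∀ s, 0 ≤ s → s < c → u s = u' s) :
    Mild Tg f x u' y c := by
  refine ⟨hy.1, fun t ht => ?_⟩
  rw [hy.2 t ht]
  congr 1
  apply intervalIntegral.integral_congr_ae
  have h0 : ∀ᵐ s : ℝ, s ≠ t := by simp [ae_iff]
  filter_upwards [h0] with s hs hs'
  rw [uIoc_of_le ht.1] at hs'
  rw [h s hs'.1.le ((lt_of_le_of_ne hs'.2 hs).trans_le ht.2)]

/-- The convolution integral with zero state is a genuine integral. -/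
def Good (Tg : C0Semigroup X) (f : X → U → X) (u : ℝ → U) (t : ℝ) : Prop :=
  IntervalIntegrable (fun s => Tg.T (t - s) (f 0 (u s))) volume 0 t

lemma Good.int {Tg : C0Semigroup X} {f : X → U → X} (hA1 : Assumption1 f) {u : ℝ → U} (hu : PCin u)
    {y : ℝ → X} {t : ℝ} (h : Good Tg f u t) (ht : 0 ≤ t) (hy : ContinuousOn y (Icc 0 t)) :
    IntervalIntegrable (fun s => Tg.T (t - s) (f (y s) (u s))) volume 0 t :=
  diff_int Tg hA1 hu (y := fun _ => 0) continuousOn_const hy ht h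

lemma not_good {Tg : C0Semigroup X} {f : X → U → X} (hA1 : Assumption1 f) {u : ℝ → U} (hu : PCin u)
    {y : ℝ → X} {t : ℝ} (h : ¬ Good Tg f u t) (ht : 0 ≤ t) (hy : ContinuousOn y (Icc 0 t)) :
    ∫ s in (0:ℝ)..t, Tg.T (t - s) (f (y s) (u s)) = 0 :=
  intervalIntegral.integral_undef fun h' =>
    h (diff_int Tg hA1 hu (z := fun _ => 0) hy continuousOn_const ht h')

lemma coc_local {Tg : C0Semigroup X} {f : X → U → X} (hA1 : Assumption1 f)
    {φ : ℝ → X → (ℝ → U) → X} (hφ : IsMildFlow Tg f φ) {x : X} {u : ℝ → U} (hu : PCin u)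
    {s c : ℝ} (hs : 0 ≤ s) (hc : 0 ≤ c) (hgood : ∀ r, 0 ≤ r → r ≤ s + c → Good Tg f u r) :
    φ (s + c) x u = φ c (φ s x u) (fun r => u (s + r)) := by
  have hcont := (hφ x u hu).2
  have hcontI : ∀ t, ContinuousOn (fun t => φ t x u) (Icc 0 t) := fun t =>
    hcont.mono Icc_subset_Ici_self
  refine Mild.unique hA1 (hu.shift hs) (y := fun t => φ (s + t) x u) (c := c) (x := φ s x u) ?_
    (hφ.mild _ (hu.shift hs) c) c ⟨hc, le_rfl⟩
  refine ⟨?_, fun t ht => ?_⟩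
  · refine hcont.comp (by fun_prop) ?_
    intro r hr
    simp only [mem_Ici]
    linarith [hr.1]
  · beta_reduce
    have hst : 0 ≤ s + t := by linarith [ht.1]
    have hi := (hgood (s+t) hst (by linarith [ht.2])).int hA1 hu hst (hcontI (s+t))
    have his := (hgood s hs (by linarith)).int hA1 hu hs (hcontI s)
    have hi1 := hi.mono_set (c := 0) (d := s) (by
      rw [uIcc_of_le hs, uIcc_of_le hst]; exact Icc_subset_Icc_right (by linarith [ht.1]))
    have hi2 := hi.mono_set (c := s) (d := s + t) (by
      rw [uIcc_of_le (by linarith [ht.1]), uIcc_of_le hst]; exact Icc_subset_Icc_left hs)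
    have e1 : ∫ r in (0:ℝ)..s, Tg.T (s + t - r) (f (φ r x u) (u r)) =
        Tg.T t (∫ r in (0:ℝ)..s, Tg.T (s - r) (f (φ r x u) (u r))) := by
      rw [← ContinuousLinearMap.intervalIntegral_comp_comm _ his]
      apply intervalIntegral.integral_congr
      intro r hr
      rw [uIcc_of_le hs] at hr
      have := Tg.semigroup' t ht.1 (s - r) (by linarith [hr.2])
      have e : s + t - r = t + (s - r) := by ring
      simp only [e, this]
      rfl
    have e2 : ∫ r in s..(s+t), Tg.T (s + t - r) (f (φ r x u) (u r)) =
        ∫ r in (0:ℝ)..t, Tg.T (t - r) (f (φ (s + r) x u) (u (s + r))) := by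
      have := intervalIntegral.integral_comp_add_left (a := 0) (b := t)
        (fun r => Tg.T (s + t - r) (f (φ r x u) (u r))) s
      rw [add_zero] at this
      rw [← this]
      apply intervalIntegral.integral_congr
      intro r _
      simp only [add_sub_add_left_eq_sub]
    rw [(hφ x u hu).1 (s+t) hst, ← intervalIntegral.integral_add_adjacent_intervals hi1 hi2, e1, e2,
      (hφ x u hu).1 s hs, map_add, ← add_assoc]
    congr 2
    rw [add_comm s t, Tg.semigroup' t ht.1 s hs]
    rfl

lemma good_of_bdd {Tg : C0Semigroup X} {f : X → U → X} (hA1 : Assumption1 f) {u : ℝ → U}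
    (hu : PCin u) {t B : ℝ} (ht : 0 ≤ t) (h : ∀ s, 0 ≤ s → s < t → ‖f 0 (u s)‖ ≤ B) :
    Good Tg f u t := by
  obtain ⟨M, hM0, hM⟩ := T_bound Tg t
  unfold Good
  rw [intervalIntegrable_iff_integrableOn_Icc_of_le ht]
  refine IntegrableOn.of_bound (by simp)
    (meas_aux Tg hA1 hu (y := fun _ => 0) continuousOn_const) (M * B) ?_
  refine (ae_restrict_iff' measurableSet_Icc).2 ?_
  have h0 : ∀ᵐ s : ℝ, s ≠ t := by simp [ae_iff]
  filter_upwards [h0] with s hs0 hs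
  refine (hM _ ⟨by linarith [hs.2], by linarith [hs.1]⟩ _).trans ?_
  exact mul_le_mul_of_nonneg_left (h s hs.1 (lt_of_le_of_ne hs.2 hs0)) hM0

lemma causal {Tg : C0Semigroup X} {f : X → U → X} (hA1 : Assumption1 f)
    {φ : ℝ → X → (ℝ → U) → X} (hφ : IsMildFlow Tg f φ) (x : X) {u u' : ℝ → U} (hu : PCin u)
    (hu' : PCin u') {c : ℝ} (hc : 0 ≤ c) (h : ∀ s, 0 ≤ s → s < c → u s = u' s) :
    φ c x u = φ c x u' :=
  Mild.unique hA1 hu' ((hφ.mild x hu c).congr_input h) (hφ.mild x hu' c) c ⟨hc, le_rfl⟩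

lemma exists_bad_point {Tg : C0Semigroup X} {f : X → U → X} (hA1 : Assumption1 f) {u : ℝ → U}
    (hu : PCin u) {c : ℝ} (hc : 0 ≤ c) (hbad : ¬ Good Tg f u c) :
    ∃ p h0 : ℝ, 0 < h0 ∧ h0 ≤ p ∧ (∀ s, p - h0 ≤ s → s < p → ContinuousWithinAt u (Ici 0) s) ∧
      ∀ h, 0 < h → h ≤ h0 →
        ¬ IntervalIntegrable (fun s => Tg.T (p - s) (f 0 (u s))) volume (p - h) p := by
  obtain ⟨M, hM0, hM⟩ := T_bound Tg c
  have hmeas := meas_aux Tg hA1 hu (t := c) (y := fun _ => 0) continuousOn_const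
  set G : ℝ → X := fun s => Tg.T (c - s) (f 0 (u s)) with hG
  have hnl : ¬ LocallyIntegrableOn G (Icc 0 c) volume := by
    intro hl
    refine hbad ?_
    unfold Good
    rw [intervalIntegrable_iff_integrableOn_Icc_of_le hc]
    exact hl.integrableOn_isCompact isCompact_Icc
  unfold LocallyIntegrableOn at hnl
  push Not at hnl
  obtain ⟨p, hp, hnp⟩ := hnl
  have hsplit : Icc 0 c = (Icc 0 c ∩ Iio p) ∪ (Icc 0 c ∩ Ici p) := by
    rw [← inter_union_distrib_left, Iio_union_Ici, inter_univ]
  rw [hsplit, nhdsWithin_union, IntegrableAtFilter.sup_iff] at hnp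
  have hright : IntegrableAtFilter G (𝓝[Icc 0 c ∩ Ici p] p) volume := by
    have h1 : ContinuousWithinAt (fun s => ‖f 0 (u s)‖) (Ici p) p :=
      ((hA1.2.1 0).continuousAt.comp_continuousWithinAt (hu.2.1 p hp.1)).norm
    have h2 : ∀ᶠ s in 𝓝[Ici p] p, ‖f 0 (u s)‖ < ‖f 0 (u p)‖ + 1 :=
      h1.tendsto.eventually (gt_mem_nhds (lt_add_one _))
    obtain ⟨q, hq, hqs⟩ := mem_nhdsGE_iff_exists_Ico_subset.1 h2
    refine ⟨Icc 0 c ∩ Ico p q, ?_, ?_⟩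
    · have h3 : Iio q ∈ 𝓝 p := Iio_mem_nhds hq
      filter_upwards [self_mem_nhdsWithin, mem_nhdsWithin_of_mem_nhds h3] with s hs hs'
      exact ⟨hs.1, hs.2, hs'⟩
    · refine IntegrableOn.of_bound ?_ (hmeas.mono_measure (Measure.restrict_mono inter_subset_left le_rfl))
        (M * (‖f 0 (u p)‖ + 1)) ?_
      · exact (measure_mono inter_subset_left).trans_lt (by simp)
      · refine (ae_restrict_iff' (measurableSet_Icc.inter measurableSet_Ico)).2
          (Eventually.of_forall fun s hs => ?_)
        refine (hM _ ⟨by linarith [hs.1.2], by linarith [hs.1.1]⟩ _).trans ?_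
        exact mul_le_mul_of_nonneg_left (le_of_lt (hqs hs.2)) hM0
  have hleft : ¬ IntegrableAtFilter G (𝓝[Icc 0 c ∩ Iio p] p) volume := fun h => hnp ⟨h, hright⟩
  have hp0 : 0 < p := by
    by_contra hcon
    have : Icc 0 c ∩ Iio p = ∅ := by
      ext s
      simp only [mem_inter_iff, mem_Icc, mem_Iio, mem_empty_iff_false, iff_false]
      rintro ⟨⟨h1, _⟩, h2⟩
      linarith
    rw [this, nhdsWithin_empty] at hleft
    exact hleft ⟨∅, mem_bot, integrableOn_empty⟩
  obtain ⟨D, hD⟩ := hu.2.2 (c + 1) (by linarith)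
  have hop : ((D.erase p : Finset ℝ) : Set ℝ)ᶜ ∈ 𝓝 p :=
    (Finset.isClosed _).isOpen_compl.mem_nhds (by simp)
  obtain ⟨e, he, hes⟩ := Metric.mem_nhds_iff.1 hop
  refine ⟨p, min p (e/2), lt_min hp0 (half_pos he), min_le_left _ _, ?_, ?_⟩
  · intro s hs hsp
    have h1 := min_le_left p (e/2)
    have h2 := min_le_right p (e/2)
    refine hD s ⟨by linarith, by linarith [hp.2]⟩ ?_
    intro hsD
    have : s ∈ Metric.ball p e := by
      rw [Metric.mem_ball, Real.dist_eq, abs_lt]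
      constructor <;> linarith
    exact hes this (by simp [hsD, hsp.ne])
  · intro h hh hh0 hint
    refine hleft ⟨Ioo (p - h) p, ?_, ?_⟩
    · have h1 : Ioi (p - h) ∈ 𝓝 p := Ioi_mem_nhds (by linarith)
      have h2 : Iio p ∈ 𝓝[Icc 0 c ∩ Iio p] p := mem_of_superset self_mem_nhdsWithin inter_subset_right
      exact inter_mem (mem_nhdsWithin_of_mem_nhds h1) h2
    · rw [intervalIntegrable_iff_integrableOn_Ioo_of_le (by linarith)] at hint
      have := (Tg.T (c - p)).integrable_comp hint
      refine IntegrableOn.congr_fun this ?_ measurableSet_Ioo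
      intro s hs
      have e1 := Tg.semigroup' (c - p) (by linarith [hp.2]) (p - s) (by linarith [hs.2])
      have e2 : c - s = (c - p) + (p - s) := by ring
      simp only [hG, e2, e1]
      rfl

lemma PCin.concat {u : ℝ → U} (hu : PCin u) (v : U) {a : ℝ} (ha : 0 ≤ a) :
    PCin (fun r => if r < a then v else u (r - a)) := by
  obtain ⟨⟨C, hC⟩, h2, h3⟩ := hu
  refine ⟨⟨max C ‖v‖, fun t ht => ?_⟩, fun t ht => ?_, fun T hT => ?_⟩
  · beta_reduce
    split_ifs with h
    · exact le_max_right _ _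
    · exact (hC _ (by linarith)).trans (le_max_left _ _)
  · by_cases h : t < a
    · have : (fun r => if r < a then v else u (r - a)) =ᶠ[𝓝 t] fun _ => v := by
        filter_upwards [Iio_mem_nhds h] with r hr
        exact if_pos hr
      exact (continuousAt_const.congr this.symm).continuousWithinAt
    · have e : ∀ r ∈ Ici t, (if r < a then v else u (r - a)) = u (r - a) := by
        intro r hr
        exact if_neg (by simp only [mem_Ici] at hr; linarith)
      refine ContinuousWithinAt.congr ?_ e (e t self_mem_Ici)
      refine ContinuousWithinAt.comp (t := Ici (t - a)) (h2 (t - a) (by linarith)) (by fun_prop) ?_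
      intro r hr
      simp only [mem_Ici] at hr ⊢
      linarith
  · obtain ⟨D, hD⟩ := h3 T hT
    refine ⟨insert a (D.image (fun d => d + a)), fun t ht htD => ?_⟩
    simp only [Finset.mem_insert, Finset.mem_image, not_or, not_exists, not_and] at htD
    by_cases h : t < a
    · have : (fun r => if r < a then v else u (r - a)) =ᶠ[𝓝 t] fun _ => v := by
        filter_upwards [Iio_mem_nhds h] with r hr
        exact if_pos hr
      exact (continuousAt_const.congr this.symm).continuousWithinAt
    · have hat : a < t := lt_of_le_of_ne (not_lt.1 h) (Ne.symm htD.1)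
      have hc := hD (t - a) ⟨by linarith, by linarith [ht.2]⟩
        (fun hh => htD.2 _ hh (by ring))
      have hc' : ContinuousAt u (t - a) := hc.continuousAt (Ici_mem_nhds (by linarith))
      have : (fun r => if r < a then v else u (r - a)) =ᶠ[𝓝 t] fun r => u (r - a) := by
        filter_upwards [Ioi_mem_nhds hat] with r hr
        exact if_neg (not_lt.2 (le_of_lt hr))
      refine (ContinuousAt.congr ?_ this.symm).continuousWithinAt
      exact ContinuousAt.comp (f := fun r => r - a) hc' (by fun_prop)

lemma bad_step {Tg : C0Semigroup X} {f : X → U → X} (hA1 : Assumption1 f)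
    {φ : ℝ → X → (ℝ → U) → X} (hφ : IsMildFlow Tg f φ) {u : ℝ → U} (hu : PCin u)
    {p h : ℝ} (hh : 0 < h) (hhp : h ≤ p)
    (hcont : ∀ s, p - h ≤ s → s < p → ContinuousWithinAt u (Ici 0) s)
    (hni : ¬ IntervalIntegrable (fun s => Tg.T (p - s) (f 0 (u s))) volume (p - h) p)
    (v : U) {a : ℝ} (ha : 0 < a) : Tg.T h (φ a 0 (fun _ => v)) = 0 := by
  set uh : ℝ → U := fun r => u (p - h + r) with huh
  have hph : 0 ≤ p - h := by linarith
  have huh' : PCin uh := hu.shift hph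
  set w : ℝ → U := fun r => if r < a then v else uh (r - a) with hw
  have hw' : PCin w := huh'.concat v ha.le
  have hwa : ∀ s, 0 ≤ s → w (a + s) = uh s := by
    intro s hs
    simp only [hw]
    rw [if_neg (by linarith), add_sub_cancel_left]
  have hbad1 : ¬ Good Tg f uh h := by
    intro hg
    have := IntervalIntegrable.comp_add_left hg (-(p - h))
    refine hni ?_
    convert this using 1
    · ext s
      have e1 : h - (-(p - h) + s) = p - s := by ring
      have e2 : p - h + (-(p - h) + s) = s := by ring
      simp only [huh, e1, e2]
    · ring
    · ring
  have hbad2 : ¬ Good Tg f w (a + h) := by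
    intro hg
    refine hbad1 ?_
    have h1 : IntervalIntegrable (fun s => Tg.T (a + h - s) (f 0 (w s))) volume a (a + h) :=
      IntervalIntegrable.mono_set hg (by
        rw [uIcc_of_le (by linarith), uIcc_of_le (by linarith)]; exact Icc_subset_Icc_left ha.le)
    have h2 := h1.comp_add_left a
    rw [sub_self, add_sub_cancel_left] at h2
    refine h2.congr ?_
    intro s hs
    rw [uIoc_of_le hh.le] at hs
    simp only [add_sub_add_left_eq_sub, hwa s hs.1.le]
  have hgood : ∀ t, 0 ≤ t → t < h → ∀ r, 0 ≤ r → r ≤ a + t → Good Tg f w r := by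
    intro t ht0 hth r hr0 hr
    have hco : ContinuousOn (fun s => f 0 (u s)) (Icc (p - h) (p - h + t)) := by
      intro s hs
      refine (hA1.2.1 0).continuousAt.comp_continuousWithinAt
        ((hcont s hs.1 (by linarith [hs.2])).mono ?_)
      intro q hq
      exact hph.trans hq.1
    obtain ⟨C, hC⟩ := isCompact_Icc.exists_bound_of_continuousOn hco
    refine good_of_bdd hA1 hw' (B := max C ‖f 0 v‖) hr0 ?_
    intro s hs0 hsr
    by_cases hsa : s < a
    · simp only [hw, if_pos hsa]; exact le_max_right _ _
    · simp only [hw, if_neg hsa]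
      exact (hC _ ⟨by linarith, by linarith⟩).trans (le_max_left _ _)
  have e1 : φ (a + h) 0 w = 0 := by
    rw [(hφ 0 w hw').1 (a + h) (by linarith),
      not_good hA1 hw' hbad2 (by linarith) (hφ.mild 0 hw' (a+h)).1]
    simp
  have e2 : φ h (φ a 0 w) uh = Tg.T h (φ a 0 w) := by
    rw [(hφ _ uh huh').1 h hh.le, not_good hA1 huh' hbad1 hh.le (hφ.mild _ huh' h).1, add_zero]
  have e3 : ∀ t, 0 ≤ t → t < h → φ (a + t) 0 w = φ t (φ a 0 w) uh := by
    intro t ht0 hth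
    rw [coc_local hA1 hφ hw' ha.le ht0 (hgood t ht0 hth)]
    exact causal hA1 hφ _ (hw'.shift ha.le) huh' ht0 (fun s hs _ => hwa s hs)
  have e4 : φ (a + h) 0 w = φ h (φ a 0 w) uh := by
    have c1 : Tendsto (fun t => φ (a + t) 0 w) (𝓝[<] h) (𝓝 (φ (a + h) 0 w)) := by
      have : ContinuousAt (fun t => φ t 0 w) (a + h) :=
        (hφ 0 w hw').2.continuousAt (Ici_mem_nhds (by linarith))
      have : ContinuousAt (fun t => φ (a + t) 0 w) h :=
        ContinuousAt.comp (f := fun t => a + t) (g := fun t => φ t 0 w) this (by fun_prop)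
      exact this.tendsto.mono_left nhdsWithin_le_nhds
    have c2 : Tendsto (fun t => φ t (φ a 0 w) uh) (𝓝[<] h) (𝓝 (φ h (φ a 0 w) uh)) := by
      have : ContinuousAt (fun t => φ t (φ a 0 w) uh) h :=
        (hφ _ uh huh').2.continuousAt (Ici_mem_nhds hh)
      exact this.tendsto.mono_left nhdsWithin_le_nhds
    refine tendsto_nhds_unique (c1.congr' ?_) c2
    filter_upwards [Ioo_mem_nhdsLT hh] with t ht
    exact e3 t ht.1.le ht.2
  have e5 : φ a 0 w = φ a 0 (fun _ => v) :=
    causal hA1 hφ 0 hw' (PCin_const v) ha.le (fun s _ hs => by simp only [hw, if_pos hs])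
  rw [← e5, ← e2, ← e4, e1]

lemma T_small_zero (Tg : C0Semigroup X) {x : X} {h0 : ℝ} (hh0 : 0 < h0)
    (h : ∀ s, 0 < s → s ≤ h0 → Tg.T s x = 0) : x = 0 := by
  have h1 : Tendsto (fun t => Tg.T t x) (𝓝[>] 0) (𝓝 (Tg.T 0 x)) :=
    ((Tg.strong_cont x) 0 self_mem_Ici).tendsto.mono_left (nhdsWithin_mono _ Ioi_subset_Ici_self)
  rw [Tg.map_zero'] at h1
  have h2 : Tendsto (fun t => Tg.T t x) (𝓝[>] 0) (𝓝 0) := by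
    refine tendsto_const_nhds.congr' ?_
    filter_upwards [Ioo_mem_nhdsGT hh0] with t ht
    exact (h t ht.1 ht.2.le).symm
  exact tendsto_nhds_unique h1 h2

lemma T_int_zero (Tg : C0Semigroup X) {x : X}
    (h : ∀ a, 0 < a → ∫ s in (0:ℝ)..a, Tg.T s x = 0) : x = 0 := by
  by_contra hx
  have hx' : 0 < ‖x‖ := norm_pos_iff.2 hx
  have h1 : Tendsto (fun t => ‖Tg.T t x - x‖) (𝓝[≥] 0) (𝓝 0) := by
    have h2 : Tendsto (fun t => Tg.T t x) (𝓝[≥] 0) (𝓝 x) := by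
      have := ((Tg.strong_cont x) 0 self_mem_Ici).tendsto
      rwa [Tg.map_zero'] at this
    have := (h2.sub_const x).norm
    simpa using this
  have h3 : ∀ᶠ t in 𝓝[≥] (0:ℝ), ‖Tg.T t x - x‖ < ‖x‖ / 2 := h1.eventually (gt_mem_nhds (half_pos hx'))
  obtain ⟨q, hq, hqs⟩ := mem_nhdsGE_iff_exists_Ico_subset.1 h3
  have hq : 0 < q := hq
  have ha : 0 < q / 2 := half_pos hq
  have hint : IntervalIntegrable (fun s => Tg.T s x) volume 0 (q/2) := by
    apply ContinuousOn.intervalIntegrable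
    rw [uIcc_of_le ha.le]
    exact (Tg.strong_cont x).mono Icc_subset_Ici_self
  have h4 : ‖∫ s in (0:ℝ)..(q/2), (Tg.T s x - x)‖ ≤ ‖x‖ / 2 * |q/2 - 0| := by
    apply intervalIntegral.norm_integral_le_of_norm_le_const
    intro s hs
    rw [uIoc_of_le ha.le] at hs
    exact le_of_lt (hqs ⟨hs.1.le, by linarith [hs.2]⟩)
  rw [intervalIntegral.integral_sub hint (by simp), h _ ha, intervalIntegral.integral_const,
    zero_sub, norm_neg, norm_smul, sub_zero, abs_of_pos ha, Real.norm_of_nonneg ha.le] at h4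
  nlinarith [mul_pos ha hx']

lemma all_good {Tg : C0Semigroup X} {f : X → U → X} (hA1 : Assumption1 f)
    {φ : ℝ → X → (ℝ → U) → X} (hφ : IsMildFlow Tg f φ) {u : ℝ → U} (hu : PCin u)
    {c : ℝ} (hc : 0 ≤ c) : Good Tg f u c := by
  by_contra hbad
  obtain ⟨p, h0, hh0, hh0p, hcont, hni⟩ := exists_bad_point hA1 hu hc hbad
  have hz : ∀ v : U, f 0 v = 0 := by
    intro v
    have hφz : ∀ a, 0 ≤ a → φ a 0 (fun _ => v) = 0 := by
      intro a ha
      rcases ha.eq_or_lt with ha | ha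
      · rw [← ha, (hφ 0 _ (PCin_const v)).1 0 le_rfl]; simp
      · refine T_small_zero Tg hh0 fun h hh hh' => ?_
        exact bad_step hA1 hφ hu hh (hh'.trans hh0p) (fun s hs hs' => hcont s (by linarith) hs')
          (hni h hh hh') v ha
    refine T_int_zero Tg fun a ha => ?_
    have h1 := (hφ 0 _ (PCin_const v)).1 a ha.le
    rw [hφz a ha.le, map_zero, zero_add] at h1
    have h2 : ∫ s in (0:ℝ)..a, Tg.T (a - s) (f (φ s 0 fun _ => v) v) =
        ∫ s in (0:ℝ)..a, Tg.T (a - s) (f 0 v) := by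
      apply intervalIntegral.integral_congr
      intro s hs
      rw [uIcc_of_le ha.le] at hs
      simp only [hφz s hs.1]
    rw [h2, intervalIntegral.integral_comp_sub_left (fun s => Tg.T s (f 0 v)) a] at h1
    simpa using h1.symm
  refine hbad (good_of_bdd hA1 hu (B := 0) hc fun s _ _ => ?_)
  simp [hz]

lemma coc {Tg : C0Semigroup X} {f : X → U → X} (hA1 : Assumption1 f)
    {φ : ℝ → X → (ℝ → U) → X} (hφ : IsMildFlow Tg f φ) : Coc φ :=
  fun _ _ hu _ hs _ ht => coc_local hA1 hφ hu hs ht fun _ hr _ => all_good hA1 hφ hu hr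

/-! ### Comparison with the undisturbed system -/

lemma gap {δ : ℝ → ℝ} {τ κ : ℝ} (hδ : ContinuousOn δ (Icc 0 τ)) (h0 : δ 0 < κ)
    (h : ∀ t ∈ Icc (0:ℝ) τ, (∀ s ∈ Icc (0:ℝ) t, δ s ≤ κ) → δ t < κ) :
    ∀ t ∈ Icc (0:ℝ) τ, δ t < κ := by
  by_contra hcon
  push Not at hcon
  obtain ⟨t0, ht0, hk⟩ := hcon
  have hS : IsCompact (Icc 0 τ ∩ δ ⁻¹' Ici κ) :=
    isCompact_Icc.of_isClosed_subset (hδ.preimage_isClosed_of_isClosed isClosed_Icc isClosed_Ici)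
      inter_subset_left
  obtain ⟨t1, ⟨ht1, hk1⟩, hleast⟩ := hS.exists_isLeast ⟨t0, ht0, hk⟩
  have hlt : ∀ s ∈ Icc (0:ℝ) τ, s < t1 → δ s < κ := by
    intro s hs hst
    by_contra hc
    exact absurd (hleast ⟨hs, not_lt.1 hc⟩) (not_le.2 hst)
  have hle : δ t1 ≤ κ := by
    have hiv := intermediate_value_Icc ht1.1 (hδ.mono (Icc_subset_Icc_right ht1.2))
    obtain ⟨s, hs, hsk⟩ := hiv ⟨h0.le, hk1⟩
    have hs' : s ∈ Icc 0 τ := ⟨hs.1, hs.2.trans ht1.2⟩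
    have : t1 ≤ s := hleast ⟨hs', hsk.ge⟩
    rw [le_antisymm this hs.2]
    exact hsk.le
  refine absurd (h t1 ht1 fun s hs => ?_) (not_lt.2 hk1)
  rcases hs.2.eq_or_lt with e | e
  · rw [e]; exact hle
  · exact (hlt s ⟨hs.1, hs.2.trans ht1.2⟩ e).le

lemma compare {Tg : C0Semigroup X} {f : X → U → X} (hA1 : Assumption1 f)
    {φ : ℝ → X → (ℝ → U) → X} (hφ : IsMildFlow Tg f φ) {σ : ℝ → ℝ} (hσ : ClassK σ) {r : ℝ}
    (hr : 0 < r) (hd : ∀ v : U, ‖v‖ < r → ∀ x : X, ‖x‖ ≤ r → ‖f x v - f x 0‖ ≤ σ ‖v‖)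
    {τ κ ρ : ℝ} (hτ : 0 ≤ τ) (hκ : 0 < κ) (hρκ : ρ + κ ≤ r) :
    ∃ η, 0 < η ∧ ∀ (x x' : X) (u : ℝ → U), ‖x - x'‖ ≤ η → PCin u → pcNorm u ≤ η →
      (∀ t ∈ Icc (0:ℝ) τ, ‖φ t x' (fun _ => 0)‖ ≤ ρ) →
      ∀ t ∈ Icc (0:ℝ) τ, ‖φ t x u - φ t x' (fun _ => 0)‖ ≤ κ := by
  obtain ⟨M, hM0, hM⟩ := T_bound Tg τ
  obtain ⟨L, hL0, hL⟩ := hA1.1 r hr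
  set B := Real.exp (M * L * τ) with hB
  have hBp : 0 < B := Real.exp_pos _
  have hQ : 0 < B * (M + τ * M + 1) := by positivity
  set e := κ / (2 * (B * (M + τ * M + 1))) with he
  have hep : 0 < e := by positivity
  have heκ : (B * (M + τ * M + 1)) * e = κ / 2 := by
    rw [he]; field_simp
  obtain ⟨δ, hδ0, hδ⟩ := hσ.pre.small hep
  refine ⟨min (min e δ) (min (r/2) (κ/2)), by positivity, ?_⟩
  intro x x' u hx hu hun hz
  simp only [le_min_iff] at hx hun
  have hz0 := PCin_const (0:U)
  have hyc := (hφ x u hu).2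
  have hzc := (hφ x' _ hz0).2
  have hyI : ∀ t, ContinuousOn (fun s => φ s x u) (Icc 0 t) := fun t => hyc.mono Icc_subset_Ici_self
  have hzI : ∀ t, ContinuousOn (fun s => φ s x' fun _ => 0) (Icc 0 t) := fun t =>
    hzc.mono Icc_subset_Ici_self
  have hT0 : ∀ (x : X) (u : ℝ → U), PCin u → φ 0 x u = x := by
    intro x u hu
    rw [(hφ x u hu).1 0 le_rfl, Tg.map_zero']; simp
  have hdI : ∀ t, ContinuousOn (fun s => ‖φ s x u - φ s x' fun _ => 0‖) (Icc 0 t) := fun t =>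
    ((hyI t).sub (hzI t)).norm
  intro t ht
  refine (gap (hdI τ) ?_ ?_ t ht).le
  · simp only [hT0 _ _ hu, hT0 _ _ hz0]
    linarith [hx.2.2]
  clear t ht
  intro t ht hle
  have hg := gronwall_int (δ := fun s => ‖φ s x u - φ s x' fun _ => 0‖) (A := (M + τ * M) * e)
    (K := M * L) (c := t) (hdI t) (by positivity) ?_ t ⟨ht.1, le_rfl⟩
  · beta_reduce at hg ⊢
    have h1 : Real.exp (M * L * t) ≤ B :=
      Real.exp_le_exp.2 (mul_le_mul_of_nonneg_left ht.2 (by positivity))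
    have h2 : (M + τ * M) * e * Real.exp (M * L * t) ≤ (M + τ * M) * e * B :=
      mul_le_mul_of_nonneg_left h1 (by positivity)
    have h3 : 0 < B * e := by positivity
    nlinarith
  · intro s hs
    have hsτ : s ≤ τ := hs.2.trans ht.2
    beta_reduce
    rw [(hφ x u hu).1 s hs.1, (hφ x' _ hz0).1 s hs.1]
    have i1 := (all_good hA1 hφ hu hs.1).int hA1 hu hs.1 (hyI s)
    have i2 := (all_good hA1 hφ hz0 hs.1).int hA1 hz0 hs.1 (hzI s)
    rw [add_sub_add_comm, ← map_sub, ← intervalIntegral.integral_sub i1 i2]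
    refine (norm_add_le _ _).trans ?_
    have a1 : ‖Tg.T s (x - x')‖ ≤ M * e :=
      (hM s ⟨hs.1, hsτ⟩ _).trans (mul_le_mul_of_nonneg_left hx.1.1 hM0)
    have hii : IntervalIntegrable (fun q => M * L * ‖φ q x u - φ q x' fun _ => 0‖) volume 0 s := by
      apply ContinuousOn.intervalIntegrable
      rw [uIcc_of_le hs.1]
      exact continuousOn_const.mul (hdI s)
    have a2 : ‖∫ q in (0:ℝ)..s, (Tg.T (s - q) (f (φ q x u) (u q)) -
        Tg.T (s - q) (f (φ q x' fun _ => 0) 0))‖ ≤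
        ∫ q in (0:ℝ)..s, (M * e + M * L * ‖φ q x u - φ q x' fun _ => 0‖) := by
      refine intervalIntegral.norm_integral_le_of_norm_le hs.1 (Eventually.of_forall fun q hq => ?_)
        (intervalIntegrable_const.add hii)
      have hqI : q ∈ Icc 0 t := ⟨hq.1.le, hq.2.trans hs.2⟩
      have hzq : ‖φ q x' fun _ => 0‖ ≤ ρ := hz q ⟨hqI.1, hqI.2.trans ht.2⟩
      have hdq : ‖φ q x u - φ q x' fun _ => 0‖ ≤ κ := hle q hqI
      have hyq : ‖φ q x u‖ ≤ r := by
        have := norm_le_norm_add_norm_sub' (φ q x u) (φ q x' fun _ => 0)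
        linarith
      have huq := hu.le hqI.1
      have b1 := hd (u q) (by linarith [hun.2.1]) _ hyq
      have b2 := hδ _ (norm_nonneg (u q)) (huq.trans hun.1.2)
      have b3 := hL _ _ hyq (hzq.trans (by linarith)) 0
      have b4 : ‖f (φ q x u) (u q) - f (φ q x' fun _ => 0) 0‖ ≤
          e + L * ‖φ q x u - φ q x' fun _ => 0‖ := by
        have := norm_sub_le_norm_sub_add_norm_sub (f (φ q x u) (u q)) (f (φ q x u) 0)
          (f (φ q x' fun _ => 0) 0)
        linarith
      rw [← map_sub]
      refine (hM _ ⟨by linarith [hq.2], by linarith [hq.1]⟩ _).trans ?_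
      refine (mul_le_mul_of_nonneg_left b4 hM0).trans (le_of_eq (by ring))
    rw [intervalIntegral.integral_add intervalIntegrable_const hii,
      intervalIntegral.integral_const, sub_zero, smul_eq_mul,
      intervalIntegral.integral_const_mul] at a2
    have a3 : s * (M * e) ≤ τ * (M * e) := mul_le_mul_of_nonneg_right hsτ (by positivity)
    linarith

lemma zero_flow {Tg : C0Semigroup X} {f : X → U → X} (hA1 : Assumption1 f)
    {φ : ℝ → X → (ℝ → U) → X} (hφ : IsMildFlow Tg f φ) {t : ℝ} (ht : 0 ≤ t) :
    φ t 0 (fun _ => 0) = 0 := by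
  refine Mild.unique hA1 (PCin_const (0:U)) (hφ.mild 0 (PCin_const (0:U)) t)
    (z := fun _ => 0) ⟨continuousOn_const, fun s _ => ?_⟩ t ⟨ht, le_rfl⟩
  simp [hA1.2.2]

lemma epsdelta_of_uag {Tg : C0Semigroup X} {f : X → U → X} (hA1 : Assumption1 f)
    (hd : PropertyDiamond f) {φ : ℝ → X → (ℝ → U) → X} (hφ : IsMildFlow Tg f φ) (h : pUAG φ) :
    EpsDelta φ := by
  obtain ⟨σ, hσ, r, hr, hd⟩ := hd
  obtain ⟨γ, hγ, h⟩ := h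
  intro ε hε
  obtain ⟨τ, hτ0, hτ⟩ := h (ε/2) (half_pos hε) 1 one_pos
  obtain ⟨δ, hδ0, hδ⟩ := hγ.toK0.pre.small (half_pos hε)
  obtain ⟨η, hη0, hη⟩ := compare hA1 hφ hσ hr hd (κ := min ε r) (ρ := 0) hτ0 (lt_min hε hr)
    (by simp)
  refine ⟨min η (min δ (1/2)), by positivity, fun x u t hx hu hun ht => ?_⟩
  simp only [le_min_iff] at hx hun
  rcases le_total t τ with htτ | htτ
  · have := hη x 0 u (by simpa using hx.1) hu hun.1
      (fun t ht => by rw [zero_flow hA1 hφ ht.1, norm_zero]) t ⟨ht, htτ⟩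
    rw [zero_flow hA1 hφ ht, sub_zero] at this
    exact this.trans (min_le_left _ _)
  · have h1 := hτ u hu x (by linarith [hx.2.2]) t htτ
    have h2 := hδ _ (pcNorm_nonneg u) hun.2.1
    linarith

lemma epsdelta_of_zero {Tg : C0Semigroup X} {f : X → U → X} (hA1 : Assumption1 f)
    (hd : PropertyDiamond f) {φ : ℝ → X → (ℝ → U) → X} (hφ : IsMildFlow Tg f φ) (hC : Coc φ)
    (hL : pULIM φ) (h : pZeroULS φ) : EpsDelta φ := by
  obtain ⟨σ, hσ, r, hr, hd⟩ := hd
  obtain ⟨γ, hγ, hL⟩ := hL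
  obtain ⟨σ0, hσ0, r0, hr0, h⟩ := h
  intro ε hε
  set ε1 := min ε r with hε1
  have hε1p : 0 < ε1 := lt_min hε hr
  obtain ⟨δ1, hδ1, hδ1s⟩ := hσ0.1.pre.small (half_pos hε1p)
  set δ := min δ1 (min r0 ε1) with hδdef
  have hδp : 0 < δ := lt_min hδ1 (lt_min hr0 hε1p)
  have hδle : δ ≤ δ1 ∧ δ ≤ r0 ∧ δ ≤ ε1 :=
    ⟨min_le_left _ _, (min_le_right _ _).trans (min_le_left _ _),
      (min_le_right _ _).trans (min_le_right _ _)⟩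
  obtain ⟨δ2, hδ2, hδ2s⟩ := hσ0.1.pre.small (half_pos hδp)
  obtain ⟨τ0, hτ0, hτ⟩ := hL (min δ2 r0) (lt_min hδ2 hr0) δ hδp
  have hz0 := PCin_const (0:U)
  have hret : ∀ x : X, ‖x‖ ≤ δ → ‖φ (τ0 + 1) x (fun _ => 0)‖ ≤ δ / 2 := by
    intro x hx
    obtain ⟨s, hs, hsx⟩ := hτ x hx _ hz0
    rw [pcNorm_zero, hγ.pre.2.2, add_zero, le_min_iff] at hsx
    have e : τ0 + 1 = s + (τ0 + 1 - s) := by ring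
    have hnn : 0 ≤ τ0 + 1 - s := by linarith [hs.2]
    rw [e, hC x _ hz0 s hs.1 _ hnn]
    exact (h _ hsx.2 _ hnn).trans (hδ2s _ (norm_nonneg _) hsx.1)
  have hstay : ∀ x : X, ‖x‖ ≤ δ → ∀ t, 0 ≤ t → ‖φ t x (fun _ => 0)‖ ≤ ε1 / 2 := fun x hx t ht =>
    (h x (hx.trans hδle.2.1) t ht).trans (hδ1s _ (norm_nonneg _) (hx.trans hδle.1))
  obtain ⟨η, hη0, hη⟩ := compare hA1 hφ hσ hr hd (κ := δ / 2) (ρ := ε1 / 2) (τ := τ0 + 1)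
    (by linarith) (half_pos hδp) (by linarith [hδle.2.2, min_le_right ε r])
  refine ⟨min δ η, lt_min hδp hη0, fun x u t hx hu hun ht => ?_⟩
  refine return_bound hC (r := δ) (c := η) (τ := τ0 + 1) (M := ε) ?_ x u
    (hx.trans (min_le_left _ _)) hu (hun.trans (min_le_right _ _)) t ht
  clear x u t hx hu hun ht
  intro x u hx hu hun
  have hc := hη x x u (by simpa using hη0.le) hu hun (fun t ht => hstay x hx t ht.1)
  refine ⟨⟨τ0 + 1, ⟨by linarith, le_rfl⟩, ?_⟩, fun t ht => ?_⟩
  · have h1 := hc (τ0 + 1) ⟨by linarith, le_rfl⟩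
    have h2 := norm_le_norm_add_norm_sub' (φ (τ0 + 1) x u) (φ (τ0 + 1) x fun _ => 0)
    linarith [hret x hx]
  · have h1 := hc t ht
    have h2 := norm_le_norm_add_norm_sub' (φ t x u) (φ t x fun _ => 0)
    linarith [hstay x hx t ht.1, hδle.2.2, min_le_left ε r]

/-- **Characterization of ISS for semilinear evolution equations**:
under Assumption 1 and property `◊` the following are equivalent:
(i) ISS; (ii) UAG ∧ BRS; (iii) ULIM ∧ ULS ∧ BRS; (iv) ULIM ∧ UGS;
(v) ULIM ∧ 0-ULS ∧ BRS. -/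
theorem evolution_iss_characterization
    (Tg : C0Semigroup X) (f : X → U → X)
    (hA1 : Assumption1 f) (hd : PropertyDiamond f)
    (φ : ℝ → X → (ℝ → U) → X) (hφ : IsMildFlow Tg f φ) :
    (pISS φ ↔ pUAG φ ∧ pBRS φ) ∧
    (pISS φ ↔ pULIM φ ∧ pULS φ ∧ pBRS φ) ∧
    (pISS φ ↔ pULIM φ ∧ pUGS φ) ∧
    (pISS φ ↔ pULIM φ ∧ pZeroULS φ ∧ pBRS φ) := by
  have hC := coc hA1 hφ
  refine ⟨⟨fun h => ?_, fun h => ?_⟩, ⟨fun h => ?_, fun h => ?_⟩, ⟨fun h => ?_, fun h => ?_⟩,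
    ⟨fun h => ?_, fun h => ?_⟩⟩
  · obtain ⟨h1, h2, -⟩ := iss_imp h
    exact ⟨h1, h2⟩
  · have hL := ulim_of_uag h.1
    exact iss_of hC hL (ugs_of hC hL h.2 (epsdelta_of_uag hA1 hd hφ h.1))
  · obtain ⟨-, h2, h3, h4, -⟩ := iss_imp h
    exact ⟨h3, h4, h2⟩
  · exact iss_of hC h.1 (ugs_of hC h.1 h.2.2 (epsdelta_of_uls h.2.1))
  · obtain ⟨-, -, h3, -, h5, -⟩ := iss_imp h
    exact ⟨h3, h5⟩
  · exact iss_of hC h.1 h.2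
  · obtain ⟨-, h2, h3, -, -, h6⟩ := iss_imp h
    exact ⟨h3, h6, h2⟩
  · exact iss_of hC h.1 (ugs_of hC h.1 h.2.2 (epsdelta_of_zero hA1 hd hφ hC h.1 h.2.1))
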